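/- arXiv:2107.11239 — 5 statements merged into one kernel-verified Lean document; each statement's English description precedes it below -/
import Mathlib

section
/- Let (Ω, F, P) and (Ω', F', P') be non-atomic probability spaces, let X₁, X₂ be real random variables on Ω with X₁ ≤ X₂ almost surely, and let X' be a real random variable on Ω' with X' ~ X₁. Then there exists a real random variable X₂' on Ω' such that X' ≤ X₂' almost surely and X₂' ~ X₂. -/
open MeasureTheory ProbabilityTheory

/-- A measure is nonatomic if every measurable set of positive measure admits a measurable
subset of strictly smaller positive measure. -/
def Nonatomic {Ω : Type*} [MeasurableSpace Ω] (μ : Measure Ω) : Prop :=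
  ∀ s : Set Ω, MeasurableSet s → 0 < μ s →
    ∃ t, t ⊆ s ∧ MeasurableSet t ∧ 0 < μ t ∧ μ t < μ s

section AEChain

variable {Ω ι : Type*} [MeasurableSpace Ω] {μ : Measure Ω}

/-- Continuity from below along a countable family that is totally ordered up to null sets. -/
theorem measure_iUnion_eq_iSup_of_ae_total [Countable ι] {A : ι → Set Ω}
    (hA : ∀ i j, A i ≤ᵐ[μ] A j ∨ A j ≤ᵐ[μ] A i) :
    μ (⋃ i, A i) = ⨆ i, μ (A i) := by
  set N : Set Ω := ⋃ (i) (j) (_ : A i ≤ᵐ[μ] A j), A i \ A j with hN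
  have hN0 : μ N = 0 := by
    simp only [hN, measure_iUnion_null_iff]
    exact fun i j h ↦ ae_le_set.1 h
  have hsub : ∀ i j, A i ≤ᵐ[μ] A j → A i \ N ⊆ A j \ N := by
    rintro i j h x ⟨hx, hxN⟩
    refine ⟨by_contra fun hxj ↦ hxN ?_, hxN⟩
    simp only [hN, Set.mem_iUnion]
    exact ⟨i, j, h, hx, hxj⟩
  have hdir : Directed (· ⊆ ·) fun i ↦ A i \ N := fun i j ↦
    (hA i j).elim (fun h ↦ ⟨j, hsub i j h, subset_rfl⟩) fun h ↦ ⟨i, subset_rfl, hsub j i h⟩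
  have := hdir.measure_iUnion (μ := μ)
  rw [← Set.iUnion_sdiff, measure_sdiff_null hN0] at this
  simpa only [measure_sdiff_null hN0] using this

/-- Continuity from above along a countable family of measurable sets that is totally ordered
up to null sets. -/
theorem measure_iInter_eq_iInf_of_ae_total [Countable ι] [Nonempty ι] [IsFiniteMeasure μ]
    {A : ι → Set Ω} (hmeas : ∀ i, MeasurableSet (A i))
    (hA : ∀ i j, A i ≤ᵐ[μ] A j ∨ A j ≤ᵐ[μ] A i) :
    μ (⋂ i, A i) = ⨅ i, μ (A i) := by
  have h := measure_iUnion_eq_iSup_of_ae_total (μ := μ) (A := fun i ↦ (A i)ᶜ)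
    fun i j ↦ (hA j i).imp Filter.EventuallyLE.compl Filter.EventuallyLE.compl
  rw [← Set.compl_iInter] at h
  rw [← compl_compl (⋂ i, A i), measure_compl (MeasurableSet.iInter hmeas).compl
    (measure_ne_top _ _), h, ENNReal.sub_iSup (measure_ne_top _ _)]
  refine iInf_congr fun i ↦ ?_
  rw [← measure_compl (hmeas i).compl (measure_ne_top _ _), compl_compl]

/-- Comparable sets (up to null sets) are ordered by their finite measures. -/
theorem ae_le_of_measure_le [IsFiniteMeasure μ] {s t : Set Ω} (ht : MeasurableSet t)
    (h : s ≤ᵐ[μ] t ∨ t ≤ᵐ[μ] s) (hle : μ s ≤ μ t) : s ≤ᵐ[μ] t := by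
  rcases h with h | h
  · exact h
  · exact (ae_eq_of_ae_subset_of_measure_ge h hle ht.nullMeasurableSet
      (measure_ne_top _ _)).symm.le

/-- On a nonatomic probability space, every totally ordered (up to null sets) family of measurable
sets extends to one in which all values in `[0, 1]` are attained by the measure. -/
theorem Nonatomic.exists_chain_measure_eq [IsProbabilityMeasure μ] (hμ : Nonatomic μ)
    {C₀ : Set (Set Ω)} (hmeas₀ : ∀ s ∈ C₀, MeasurableSet s)
    (hchain₀ : ∀ s ∈ C₀, ∀ t ∈ C₀, s ≤ᵐ[μ] t ∨ t ≤ᵐ[μ] s) :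
    ∃ C : Set (Set Ω), C₀ ⊆ C ∧ (∀ s ∈ C, MeasurableSet s) ∧
      (∀ s ∈ C, ∀ t ∈ C, s ≤ᵐ[μ] t ∨ t ≤ᵐ[μ] s) ∧ ∀ u ≤ 1, ∃ s ∈ C, μ s = u := by
  let r : {s : Set Ω // MeasurableSet s} → {s : Set Ω // MeasurableSet s} → Prop :=
    fun s t ↦ (s : Set Ω) ≤ᵐ[μ] (t : Set Ω)
  have hc₀ : IsChain r {s | (s : Set Ω) ∈ C₀} := fun s hs t ht _ ↦ hchain₀ s hs t ht
  obtain ⟨M, hM, hCM⟩ := hc₀.exists_maxChain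
  have hchain : ∀ s ∈ M, ∀ t ∈ M, r s t ∨ r t s := by
    intro s hs t ht
    by_cases hst : s = t
    · exact hst ▸ Or.inl Filter.EventuallyLE.rfl
    · exact hM.isChain hs ht hst
  have hmax : ∀ s, (∀ t ∈ M, r s t ∨ r t s) → s ∈ M := fun s hs ↦ by
    rw [hM.2 (hM.isChain.insert fun t ht _ ↦ hs t ht) (Set.subset_insert s M)]
    exact Set.mem_insert s M
  refine ⟨Subtype.val '' M, fun s hs ↦ ⟨⟨s, hmeas₀ s hs⟩, hCM hs, rfl⟩, ?_, ?_, ?_⟩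
  · rintro _ ⟨s, -, rfl⟩
    exact s.2
  · rintro _ ⟨s, hs, rfl⟩ _ ⟨t, ht, rfl⟩
    exact hchain s hs t ht
  intro u hu
  have hempty : (⟨∅, .empty⟩ : {s : Set Ω // MeasurableSet s}) ∈ M :=
    hmax _ fun t _ ↦ Or.inl (Filter.Eventually.of_forall fun x hx ↦ hx.elim)
  have huniv : (⟨Set.univ, .univ⟩ : {s : Set Ω // MeasurableSet s}) ∈ M :=
    hmax _ fun t _ ↦ Or.inr (Filter.Eventually.of_forall fun x _ ↦ trivial)
  obtain ⟨L, hLM, hLu, hL⟩ : ∃ L ∈ M, μ L.1 ≤ u ∧ ∀ t ∈ M, μ t.1 ≤ u → μ t.1 ≤ μ L.1 := by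
    obtain ⟨v, -, hv, hvS⟩ := exists_seq_tendsto_sSup
      (S := (fun s : {s : Set Ω // MeasurableSet s} ↦ μ s.1) '' {s ∈ M | μ s.1 ≤ u})
      ⟨_, _, ⟨hempty, by simp⟩, rfl⟩ (OrderTop.bddAbove _)
    choose A hA hAv using hvS
    have hU := measure_iUnion_eq_iSup_of_ae_total fun i j ↦ hchain _ (hA i).1 _ (hA j).1
    refine ⟨⟨⋃ n, (A n).1, .iUnion fun n ↦ (A n).2⟩, hmax _ fun t ht ↦ ?_, ?_, fun t ht htu ↦ ?_⟩
    · by_cases h : ∃ n, r t (A n)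
      · obtain ⟨n, hn⟩ := h
        exact Or.inr (hn.trans (Set.subset_iUnion (fun n ↦ (A n).1) n).eventuallyLE)
      · push Not at h
        refine Or.inl ?_
        have h' : ∀ n, r (A n) t := fun n ↦ (hchain _ (hA n).1 t ht).resolve_right (h n)
        filter_upwards [ae_all_iff.2 h'] with x hx hxU
        obtain ⟨n, hn⟩ := Set.mem_iUnion.1 hxU
        exact hx n hn
    · exact hU.trans_le (iSup_le fun n ↦ (hA n).2)
    · refine le_trans (le_sSup ?_) (le_of_tendsto' hv fun n ↦ ?_)
      · exact ⟨t, ⟨ht, htu⟩, rfl⟩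
      rw [← hAv n]
      exact measure_mono (Set.subset_iUnion (fun n ↦ (A n).1) n)
  obtain ⟨H, hHM, hHu, hH⟩ : ∃ H ∈ M, u ≤ μ H.1 ∧ ∀ t ∈ M, u ≤ μ t.1 → μ H.1 ≤ μ t.1 := by
    obtain ⟨v, -, hv, hvS⟩ := exists_seq_tendsto_sInf
      (S := (fun s : {s : Set Ω // MeasurableSet s} ↦ μ s.1) '' {s ∈ M | u ≤ μ s.1})
      ⟨_, _, ⟨huniv, by simpa using hu⟩, rfl⟩ (OrderBot.bddBelow _)
    choose A hA hAv using hvS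
    have hU := measure_iInter_eq_iInf_of_ae_total (fun i ↦ (A i).2)
      fun i j ↦ hchain _ (hA i).1 _ (hA j).1
    refine ⟨⟨⋂ n, (A n).1, .iInter fun n ↦ (A n).2⟩, hmax _ fun t ht ↦ ?_, ?_, fun t ht htu ↦ ?_⟩
    · by_cases h : ∃ n, r (A n) t
      · obtain ⟨n, hn⟩ := h
        exact Or.inl ((Set.iInter_subset (fun n ↦ (A n).1) n).eventuallyLE.trans hn)
      · push Not at h
        refine Or.inr ?_
        have h' : ∀ n, r t (A n) := fun n ↦ (hchain _ (hA n).1 t ht).resolve_left (h n)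
        filter_upwards [ae_all_iff.2 h'] with x hx hxt
        exact Set.mem_iInter.2 fun n ↦ hx n hxt
    · exact (le_iInf fun n ↦ (hA n).2).trans_eq hU.symm
    · refine le_trans (ge_of_tendsto' hv fun n ↦ ?_) (sInf_le ?_)
      swap
      · exact ⟨t, ⟨ht, htu⟩, rfl⟩
      rw [← hAv n]
      exact measure_mono (Set.iInter_subset (fun n ↦ (A n).1) n)
  refine ⟨L, ⟨L, hLM, rfl⟩, hLu.antisymm (not_lt.1 fun hlt ↦ ?_)⟩
  have hdiff : 0 < μ (H.1 \ L.1) :=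
    (tsub_pos_of_lt (hlt.trans_le hHu)).trans_le le_measure_sdiff
  obtain ⟨t, hts, htm, ht0, htlt⟩ := hμ _ (H.2.diff L.2) hdiff
  have hdisj : Disjoint L.1 t := Set.disjoint_sdiff_right.mono_right hts
  have hLH : r L H := ae_le_of_measure_le H.2 (hchain L hLM H hHM) (hLu.trans hHu)
  have hTH : (L.1 ∪ t : Set Ω) ≤ᵐ[μ] H.1 := by
    filter_upwards [hLH] with x hx hxU
    exact hxU.elim hx fun h ↦ (hts h).1
  have hTM : (⟨L.1 ∪ t, L.2.union htm⟩ : {s : Set Ω // MeasurableSet s}) ∈ M := by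
    refine hmax _ fun s hs ↦ ?_
    rcases le_total (μ s.1) u with hsu | hus
    · exact Or.inr ((ae_le_of_measure_le L.2 (hchain s hs L hLM) (hL s hs hsu)).trans
        Set.subset_union_left.eventuallyLE)
    · exact Or.inl (hTH.trans (ae_le_of_measure_le s.2 (hchain H hHM s hs) (hH s hs hus)))
  have hTμ : μ (L.1 ∪ t) = μ L.1 + μ t := measure_union hdisj htm
  rcases le_total (μ (L.1 ∪ t)) u with hTu | huT
  · have := hL _ hTM hTu
    exact (ENNReal.lt_add_right (measure_ne_top μ L.1) ht0.ne').not_ge (hTμ ▸ this)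
  · have h1 : μ H.1 ≤ μ L.1 + μ t := hTμ ▸ hH _ hTM huT
    have h2 : μ L.1 + μ (H.1 \ L.1) = μ H.1 := by
      rw [← measure_union Set.disjoint_sdiff_right (H.2.diff L.2), Set.union_sdiff_self]
      refine le_antisymm (measure_mono_ae ?_) (measure_mono Set.subset_union_right)
      filter_upwards [hLH] with x hx hxU
      exact hxU.elim hx id
    exact (ENNReal.add_lt_add_left (measure_ne_top μ L.1) htlt).not_ge (h2.trans_le h1)

end AEChain

/-- If `X' ~ X₁ ≤ X₂`, then there is `X₂'` on the second space with `X' ≤ X₂' ~ X₂`. -/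
theorem exists_identDistrib_ge
    {Ω Ω' : Type*} [MeasurableSpace Ω] [MeasurableSpace Ω']
    (P : Measure Ω) (P' : Measure Ω')
    [IsProbabilityMeasure P] [IsProbabilityMeasure P']
    (hP : Nonatomic P) (hP' : Nonatomic P')
    (X₁ X₂ : Ω → ℝ) (hX₁ : Measurable X₁) (hX₂ : Measurable X₂)
    (hle : ∀ᵐ ω ∂P, X₁ ω ≤ X₂ ω)
    (X' : Ω' → ℝ) (hX' : Measurable X')
    (hdist : IdentDistrib X' X₁ P' P) :
    ∃ X₂' : Ω' → ℝ, Measurable X₂' ∧ (∀ᵐ ω ∂P', X' ω ≤ X₂' ω) ∧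
      IdentDistrib X₂' X₂ P' P := by
  obtain ⟨C, hXC, hCmeas, hC, hCμ⟩ := hP'.exists_chain_measure_eq
    (C₀ := Set.range fun x : ℝ ↦ X' ⁻¹' Set.Iic x)
    (by rintro _ ⟨x, rfl⟩; exact hX' measurableSet_Iic)
    (by
      rintro _ ⟨x, rfl⟩ _ ⟨y, rfl⟩
      exact (le_total x y).imp
        (fun h ↦ (Set.preimage_mono (Set.Iic_subset_Iic.2 h)).eventuallyLE)
        (fun h ↦ (Set.preimage_mono (Set.Iic_subset_Iic.2 h)).eventuallyLE))
  choose A hAC hAμ using fun q : ℚ ↦ hCμ (P (X₂ ⁻¹' Set.Iic (q : ℝ))) prob_le_one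
  have hAX : ∀ q : ℚ, A q ≤ᵐ[P'] X' ⁻¹' Set.Iic (q : ℝ) := fun q ↦ by
    refine ae_le_of_measure_le (hX' measurableSet_Iic) (hC _ (hAC q) _ (hXC ⟨q, rfl⟩)) ?_
    rw [hAμ, hdist.measure_mem_eq measurableSet_Iic]
    refine measure_mono_ae ?_
    filter_upwards [hle] with ω hω hq using hω.trans hq
  set B : ℚ → Set Ω' := fun q ↦ A q ∩ X' ⁻¹' Set.Iic (q : ℝ)
  have hBm : ∀ q, MeasurableSet (B q) := fun q ↦
    (hCmeas _ (hAC q)).inter (hX' measurableSet_Iic)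
  have hBA : ∀ q, B q =ᵐ[P'] A q := fun q ↦ by
    refine Set.inter_subset_left.eventuallyLE.antisymm ?_
    filter_upwards [hAX q] with ω hω hA using ⟨hA, hω hA⟩
  have hBμ : ∀ q, P' (B q) = P (X₂ ⁻¹' Set.Iic (q : ℝ)) := fun q ↦
    (measure_congr (hBA q)).trans (hAμ q)
  have hBt : ∀ p q, B p ≤ᵐ[P'] B q ∨ B q ≤ᵐ[P'] B p := fun p q ↦
    (hC _ (hAC p) _ (hAC q)).imp
      (fun h ↦ (hBA p).le.trans (h.trans (hBA q).symm.le))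
      (fun h ↦ (hBA q).le.trans (h.trans (hBA p).symm.le))
  have hUnion : ∀ S : Set ℚ, P' (⋃ q : S, B q) = P (⋃ q : S, X₂ ⁻¹' Set.Iic ((q : ℚ) : ℝ)) := by
    intro S
    rw [measure_iUnion_eq_iSup_of_ae_total fun p q : S ↦ hBt p q,
      measure_iUnion_eq_iSup_of_ae_total fun p q : S ↦ ?_]
    · exact iSup_congr fun q ↦ hBμ q
    · exact (le_total (p : ℚ) q).imp
        (fun h ↦ (Set.preimage_mono (Set.Iic_subset_Iic.2 (Rat.cast_le.2 h))).eventuallyLE)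
        (fun h ↦ (Set.preimage_mono (Set.Iic_subset_Iic.2 (Rat.cast_le.2 h))).eventuallyLE)
  set G : Set Ω' := ⋃ q : (Set.univ : Set ℚ), B q with hG
  have hGm : MeasurableSet G := .iUnion fun q ↦ hBm q
  have hGμ : ∀ᵐ ω ∂P', ω ∈ G := by
    change G ∈ ae P'
    rw [mem_ae_iff_prob_eq_one hGm, hG, hUnion, ← measure_univ (μ := P)]
    congr 1
    refine Set.eq_univ_of_forall fun ω ↦ ?_
    obtain ⟨q, hq⟩ := exists_rat_gt (X₂ ω)
    exact Set.mem_iUnion.2 ⟨⟨q, trivial⟩, hq.le⟩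
  let T : Ω' → Set ℝ := fun ω ↦ (fun q : ℚ ↦ (q : ℝ)) '' {q | ω ∈ B q}
  have hTlb : ∀ ω, X' ω ∈ lowerBounds (T ω) := by
    rintro ω _ ⟨q, hq, rfl⟩
    exact hq.2
  have hTne : ∀ ω ∈ G, (T ω).Nonempty := by
    intro ω hω
    obtain ⟨q, hq⟩ := Set.mem_iUnion.1 hω
    exact ⟨_, q, hq, rfl⟩
  have hlt : ∀ ω ∈ G, ∀ x : ℝ, sInf (T ω) < x ↔ ω ∈ ⋃ q : {q : ℚ | (q : ℝ) < x}, B q := by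
    intro ω hω x
    rw [csInf_lt_iff ⟨_, hTlb ω⟩ (hTne ω hω)]
    simp [T, and_comm]
  have hm : Measurable fun ω ↦ sInf (T ω) := by
    refine measurable_of_Iio fun x ↦ ?_
    have hempty : ∀ ω ∉ G, T ω = ∅ := fun ω hω ↦ by
      refine Set.eq_empty_of_forall_notMem ?_
      rintro _ ⟨q, hq, rfl⟩
      exact hω (Set.mem_iUnion.2 ⟨⟨q, trivial⟩, hq⟩)
    have heq : (fun ω ↦ sInf (T ω)) ⁻¹' Set.Iio x =
        G ∩ (⋃ q : {q : ℚ | (q : ℝ) < x}, B q) ∪ Gᶜ ∩ {_ω | 0 < x} := by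
      ext ω
      by_cases hω : ω ∈ G
      · simpa [hω] using hlt ω hω x
      · simp [hω, hempty ω hω]
    rw [heq]
    exact (hGm.inter (.iUnion fun q : {q : ℚ | (q : ℝ) < x} ↦ hBm q)).union (hGm.compl.inter (.const _))
  refine ⟨fun ω ↦ sInf (T ω), hm, ?_, hm.aemeasurable, hX₂.aemeasurable, ?_⟩
  · filter_upwards [hGμ] with ω hω using le_csInf (hTne ω hω) (hTlb ω)
  have := Measure.isProbabilityMeasure_map (μ := P') hm.aemeasurable
  have := Measure.isProbabilityMeasure_map (μ := P) hX₂.aemeasurable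
  refine Measure.ext_of_Ici _ _ fun x ↦ ?_
  rw [← Set.compl_Iio, prob_compl_eq_one_sub measurableSet_Iio,
    prob_compl_eq_one_sub measurableSet_Iio, Measure.map_apply hm measurableSet_Iio,
    Measure.map_apply hX₂ measurableSet_Iio]
  congr 1
  calc P' ((fun ω ↦ sInf (T ω)) ⁻¹' Set.Iio x)
      = P' (⋃ q : {q : ℚ | (q : ℝ) < x}, B q) := by
        refine measure_congr (Filter.eventuallyEq_set.2 ?_)
        filter_upwards [hGμ] with ω hω using hlt ω hω x
    _ = P (X₂ ⁻¹' Set.Iio x) := by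
        rw [hUnion]
        congr 1
        ext ω
        simp only [Set.mem_iUnion, Set.mem_preimage, Set.mem_Iic, Set.mem_Iio]
        refine ⟨fun ⟨q, hq⟩ ↦ hq.trans_lt q.2, fun h ↦ ?_⟩
        obtain ⟨q, hq, hqx⟩ := exists_rat_btwn h
        exact ⟨⟨q, hqx⟩, hq.le⟩
end

section
/- Let (Ω, F, P) be a non-atomic probability space and let Y : Ω → ℝ be integrable. If ∫_A Y dP = ∫_B Y dP for all measurable sets A, B ∈ F with P(A) = P(B), then Y = E[Y] almost surely (Y is almost surely equal to the constant ∫ Y dP). -/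
open MeasureTheory

namespace Nonatomic

variable {Ω : Type*} [MeasurableSpace Ω] {μ : Measure Ω} [IsFiniteMeasure μ]

/-- Every set of positive measure has a subset of positive and at most half its measure. -/
lemma exists_subset_le_half (hμ : Nonatomic μ) {s : Set Ω} (hs : MeasurableSet s)
    (hpos : 0 < μ.real s) :
    ∃ t ⊆ s, MeasurableSet t ∧ 0 < μ.real t ∧ μ.real t ≤ μ.real s / 2 := by
  obtain ⟨t, hts, ht, ht0, hlt⟩ := hμ s hs (ENNReal.toReal_pos_iff.1 hpos).1
  have h0 : 0 < μ.real t := ENNReal.toReal_pos ht0.ne' (measure_ne_top μ t)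
  have h1 : μ.real t < μ.real s := ENNReal.toReal_strict_mono (measure_ne_top μ s) hlt
  have h2 : μ.real (s \ t) = μ.real s - μ.real t := measureReal_sdiff hts ht
  by_cases h : μ.real t ≤ μ.real s / 2
  · exact ⟨t, hts, ht, h0, h⟩
  · exact ⟨s \ t, Set.sdiff_subset, hs.diff ht, by linarith, by linarith⟩

/-- Every set of positive measure has subsets of arbitrarily small positive measure. -/
lemma exists_subset_lt (hμ : Nonatomic μ) {s : Set Ω} (hs : MeasurableSet s)
    (hpos : 0 < μ.real s) {ε : ℝ} (hε : 0 < ε) :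
    ∃ t ⊆ s, MeasurableSet t ∧ 0 < μ.real t ∧ μ.real t < ε := by
  have key (n : ℕ) :
      ∃ t ⊆ s, MeasurableSet t ∧ 0 < μ.real t ∧ μ.real t ≤ μ.real s * (1 / 2) ^ n := by
    induction n with
    | zero => exact ⟨s, subset_rfl, hs, hpos, by simp⟩
    | succ n ih =>
      obtain ⟨t, hts, ht, h0, hle⟩ := ih
      obtain ⟨u, hut, hu, hu0, hule⟩ := hμ.exists_subset_le_half ht h0
      exact ⟨u, hut.trans hts, hu, hu0, by rw [pow_succ]; linarith⟩
  obtain ⟨n, hn⟩ := exists_pow_lt_of_lt_one (div_pos hε hpos) (one_half_lt_one (α := ℝ))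
  obtain ⟨t, hts, ht, h0, hle⟩ := key n
  exact ⟨t, hts, ht, h0, hle.trans_lt (by rwa [mul_comm, ← lt_div_iff₀ hpos])⟩

end Nonatomic

/-- Among the measurable subsets of `s` of measure at most `r`, there is one whose measure cannot
be increased by passing to a larger such subset. -/
lemma exists_maximal_measureReal_le {Ω : Type*} [MeasurableSpace Ω] (μ : Measure Ω)
    [IsFiniteMeasure μ] (s : Set Ω) {r : ℝ} (hr : 0 ≤ r) :
    ∃ t ⊆ s, MeasurableSet t ∧ μ.real t ≤ r ∧
      ∀ u ⊆ s, MeasurableSet u → μ.real u ≤ r → t ⊆ u → μ.real u ≤ μ.real t := by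
  let C : Type _ := {t : Set Ω // t ⊆ s ∧ MeasurableSet t ∧ μ.real t ≤ r}
  have step (t : C) : ∃ t' : C, t.1 ⊆ t'.1 ∧
      ∀ u : C, t.1 ⊆ u.1 → μ.real u.1 + μ.real t.1 ≤ 2 * μ.real t'.1 := by
    by_contra! hcon
    let S : Set ℝ := {x | ∃ u : C, t.1 ⊆ u.1 ∧ μ.real u.1 = x}
    have hS : BddAbove S := ⟨r, by rintro _ ⟨u, -, rfl⟩; exact u.2.2.2⟩
    obtain ⟨u, htu, hu⟩ := hcon t subset_rfl
    have hlt : (sSup S + μ.real t.1) / 2 < sSup S := by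
      linarith [le_csSup hS ⟨u, htu, rfl⟩]
    obtain ⟨_, ⟨v, htv, rfl⟩, hv⟩ := exists_lt_of_lt_csSup (s := S) ⟨_, u, htu, rfl⟩ hlt
    obtain ⟨w, htw, hw⟩ := hcon v htv
    linarith [le_csSup hS ⟨w, htw, rfl⟩]
  choose f hf hfmax using step
  let T : ℕ → C := fun n => f^[n] ⟨∅, by simp, by simp, by simpa using hr⟩
  have hT (n : ℕ) : T (n + 1) = f (T n) := Function.iterate_succ_apply' f n _
  have hmono : Monotone fun n => (T n).1 := monotone_nat_of_le_succ fun n => by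
    rw [hT]; exact hf _
  have hlim : Filter.Tendsto (fun n => μ.real (T n).1) Filter.atTop
      (nhds (μ.real (⋃ n, (T n).1))) :=
    (ENNReal.tendsto_toReal (measure_ne_top μ _)).comp (tendsto_measure_iUnion_atTop hmono)
  refine ⟨⋃ n, (T n).1, Set.iUnion_subset fun n => (T n).2.1,
    MeasurableSet.iUnion fun n => (T n).2.2.1,
    le_of_tendsto' hlim fun n => (T n).2.2.2, fun u hus hu hur htu => ?_⟩
  have h := le_of_tendsto_of_tendsto' (hlim.const_add (μ.real u))
    (((Filter.tendsto_add_atTop_iff_nat 1).2 hlim).const_mul 2) fun n => by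
      rw [hT]
      exact hfmax (T n) ⟨u, hus, hu, hur⟩ ((Set.subset_iUnion _ n).trans htu)
  linarith

/-- **Sierpiński's theorem**: a finite nonatomic measure takes all intermediate values. -/
lemma Nonatomic.exists_subset_measureReal_eq {Ω : Type*} [MeasurableSpace Ω] {μ : Measure Ω}
    [IsFiniteMeasure μ] (hμ : Nonatomic μ) {s : Set Ω} (hs : MeasurableSet s) {r : ℝ}
    (hr : 0 ≤ r) (hrs : r ≤ μ.real s) :
    ∃ t ⊆ s, MeasurableSet t ∧ μ.real t = r := by
  obtain ⟨t, hts, ht, htr, hmax⟩ := exists_maximal_measureReal_le μ s hr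
  refine ⟨t, hts, ht, htr.antisymm (not_lt.1 fun hlt => ?_)⟩
  have hdiff : μ.real (s \ t) = μ.real s - μ.real t := measureReal_sdiff hts ht
  obtain ⟨u, hus, hu, hu0, hur⟩ :=
    hμ.exists_subset_lt (hs.diff ht) (by linarith) (sub_pos.2 hlt)
  have hunion : μ.real (t ∪ u) = μ.real t + μ.real u :=
    measureReal_union (Set.disjoint_of_subset_right hus Set.disjoint_sdiff_right) hu
  have := hmax (t ∪ u) (Set.union_subset hts (hus.trans Set.sdiff_subset)) (ht.union hu)
    (by linarith) Set.subset_union_left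
  linarith

/-- The integral of a positive function over a set of positive measure is positive. -/
lemma setIntegral_pos_of_forall_mem {Ω : Type*} [MeasurableSpace Ω] {μ : Measure Ω}
    {f : Ω → ℝ} (hf : Integrable f μ) {s : Set Ω} (hs : MeasurableSet s) (hpos : 0 < μ.real s)
    (h : ∀ x ∈ s, 0 < f x) : 0 < ∫ x in s, f x ∂μ := by
  rw [setIntegral_pos_iff_support_of_nonneg_ae
    (ae_restrict_of_forall_mem hs fun x hx => (h x hx).le) hf.integrableOn,
    Set.inter_eq_right.2 fun x hx => Function.mem_support.2 (h x hx).ne']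
  exact (ENNReal.toReal_pos_iff.1 hpos).1

/-- If `∫ f` over a set depends only on the measure of the set, then `f` cannot be both above and
below a constant with positive measure. -/
lemma Nonatomic.measureReal_gt_eq_zero_or_lt_eq_zero {Ω : Type*} [MeasurableSpace Ω]
    {μ : Measure Ω} [IsFiniteMeasure μ] (hμ : Nonatomic μ) {f : Ω → ℝ} (hf : Integrable f μ)
    (hfm : Measurable f)
    (h : ∀ A B : Set Ω, MeasurableSet A → MeasurableSet B → μ A = μ B →
      ∫ x in A, f x ∂μ = ∫ x in B, f x ∂μ) (c : ℝ) :
    μ.real {x | c < f x} = 0 ∨ μ.real {x | f x < c} = 0 := by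
  by_contra! hcon
  have hgt : 0 < μ.real {x | c < f x} := measureReal_nonneg.lt_of_ne' hcon.1
  have hlt : 0 < μ.real {x | f x < c} := measureReal_nonneg.lt_of_ne' hcon.2
  have hmin := lt_min hgt hlt
  obtain ⟨A, hAs, hA, hAr⟩ := hμ.exists_subset_measureReal_eq
    (measurableSet_lt measurable_const hfm) hmin.le (min_le_left _ _)
  obtain ⟨B, hBs, hB, hBr⟩ := hμ.exists_subset_measureReal_eq
    (measurableSet_lt hfm measurable_const) hmin.le (min_le_right _ _)
  have hAB : μ A = μ B := (measureReal_eq_measureReal_iff).1 (hAr.trans hBr.symm)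
  have hc := integrable_const (μ := μ) c
  have h1 := setIntegral_pos_of_forall_mem (hf.sub hc) hA (hAr ▸ hmin)
    fun x hx => sub_pos.2 (hAs hx)
  have h2 := setIntegral_pos_of_forall_mem (hc.sub hf) hB (hBr ▸ hmin)
    fun x hx => sub_pos.2 (hBs hx)
  simp only [Pi.sub_apply] at h1 h2
  rw [integral_sub hf.integrableOn hc.integrableOn, setIntegral_const, hAr] at h1
  rw [integral_sub hc.integrableOn hf.integrableOn, setIntegral_const, hBr] at h2
  linarith [h A B hA hB hAB]

/-- If the integral of an integrable `Y` over a measurable set depends only on the measure of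
the set, then `Y` is a.s. equal to its mean. -/
theorem ae_eq_integral_of_setIntegral_eq_of_measure_eq
    {Ω : Type*} [MeasurableSpace Ω] (P : Measure Ω) [IsProbabilityMeasure P]
    (hP : Nonatomic P) (Y : Ω → ℝ) (hY : Integrable Y P)
    (h : ∀ A B : Set Ω, MeasurableSet A → MeasurableSet B → P A = P B →
      ∫ ω in A, Y ω ∂P = ∫ ω in B, Y ω ∂P) :
    ∀ᵐ ω ∂P, Y ω = ∫ ω', Y ω' ∂P := by
  let Z : Ω → ℝ := hY.1.mk Y
  have hYZ : Y =ᵐ[P] Z := hY.1.ae_eq_mk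
  have hZ : Integrable Z P := hY.congr hYZ
  have hZh (A B : Set Ω) (hA : MeasurableSet A) (hB : MeasurableSet B) (hAB : P A = P B) :
      ∫ ω in A, Z ω ∂P = ∫ ω in B, Z ω ∂P := by
    rw [← integral_congr_ae (ae_restrict_of_ae hYZ), ← integral_congr_ae (ae_restrict_of_ae hYZ)]
    exact h A B hA hB hAB
  rw [integral_congr_ae hYZ]
  have hc := integrable_const (μ := P) (∫ ω, Z ω ∂P)
  rcases hP.measureReal_gt_eq_zero_or_lt_eq_zero hZ hY.1.stronglyMeasurable_mk.measurable hZh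
    (∫ ω, Z ω ∂P) with h0 | h0
  · have hle : Z ≤ᵐ[P] fun _ => ∫ ω, Z ω ∂P := by
      rw [measureReal_eq_zero_iff] at h0
      simpa [Filter.EventuallyLE, ae_iff] using h0
    exact hYZ.trans ((integral_eq_iff_of_ae_le hZ hc hle).1 (by simp))
  · have hle : (fun _ => ∫ ω, Z ω ∂P) ≤ᵐ[P] Z := by
      rw [measureReal_eq_zero_iff] at h0
      simpa [Filter.EventuallyLE, ae_iff] using h0
    exact hYZ.trans ((integral_eq_iff_of_ae_le hc hZ hle).1 (by simp)).symm
end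

section
/- Let (Ω, F, P) be a non-atomic probability space, let p ∈ [1, ∞], and let ρ : L^p(P) → ℝ be a law-invariant bounded linear functional. Then for all X, X' ∈ L^p(P) with X ≥ 0, X' ≥ 0 and X ~ X', one has sup{ ρ(Z) : Z ∈ L^p(P), 0 ≤ Z ≤ X } = sup{ ρ(Z) : Z ∈ L^p(P), 0 ≤ Z ≤ X' }. -/
open MeasureTheory ProbabilityTheory
open scoped ENNReal

/-- A nonatomic finite measure has measurable subsets of arbitrarily small positive measure. -/
theorem Nonatomic.exists_small_subset {Ω : Type*} [MeasurableSpace Ω] {μ : Measure Ω}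
    [IsFiniteMeasure μ] (hμ : Nonatomic μ) {s : Set Ω} (hs : MeasurableSet s) (hs0 : 0 < μ.real s)
    {ε : ℝ} (hε : 0 < ε) :
    ∃ t, t ⊆ s ∧ MeasurableSet t ∧ 0 < μ.real t ∧ μ.real t ≤ ε := by
  have halve : ∀ s : Set Ω, MeasurableSet s → 0 < μ.real s →
      ∃ t, t ⊆ s ∧ MeasurableSet t ∧ 0 < μ.real t ∧ μ.real t ≤ μ.real s / 2 := by
    intro s hs h0
    obtain ⟨t, hts, ht, ht0, hlt⟩ := hμ s hs (ENNReal.toReal_pos_iff.1 h0).1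
    have h1 : 0 < μ.real t := ENNReal.toReal_pos ht0.ne' (measure_ne_top _ _)
    have h2 : μ.real t < μ.real s :=
      (ENNReal.toReal_lt_toReal (measure_ne_top _ _) (measure_ne_top _ _)).2 hlt
    have h3 : μ.real (s \ t) = μ.real s - μ.real t := measureReal_sdiff hts ht
    by_cases h : μ.real t ≤ μ.real s / 2
    · exact ⟨t, hts, ht, h1, h⟩
    · exact ⟨s \ t, Set.sdiff_subset, hs.diff ht, by linarith, by linarith⟩
  have iterate : ∀ n : ℕ, ∃ t, t ⊆ s ∧ MeasurableSet t ∧ 0 < μ.real t ∧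
      μ.real t ≤ μ.real s * (1 / 2) ^ n := by
    intro n
    induction n with
    | zero => exact ⟨s, subset_rfl, hs, hs0, by simp⟩
    | succ n ih =>
      obtain ⟨t, hts, ht, h0, hle⟩ := ih
      obtain ⟨u, hut, hu, hu0, hule⟩ := halve t ht h0
      exact ⟨u, hut.trans hts, hu, hu0, by rw [pow_succ]; linarith⟩
  obtain ⟨n, hn⟩ := exists_pow_lt_of_lt_one (div_pos hε hs0) (by norm_num : (1 / 2 : ℝ) < 1)
  obtain ⟨t, hts, ht, h0, hle⟩ := iterate n
  rw [lt_div_iff₀ hs0] at hn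
  exact ⟨t, hts, ht, h0, by linarith⟩

/-- Sierpiński's theorem: a nonatomic finite measure takes all intermediate values
between nested measurable sets. -/
theorem Nonatomic.exists_between {Ω : Type*} [MeasurableSpace Ω] {μ : Measure Ω}
    [IsFiniteMeasure μ] (hμ : Nonatomic μ) {B A : Set Ω} (hB : MeasurableSet B)
    (hA : MeasurableSet A) (hBA : B ⊆ A) {c : ℝ} (hBc : μ.real B ≤ c) (hcA : c ≤ μ.real A) :
    ∃ C, B ⊆ C ∧ C ⊆ A ∧ MeasurableSet C ∧ μ.real C = c := by
  let T : Set (Set Ω) := {D | D ⊆ A ∧ MeasurableSet D ∧ μ.real D ≤ c}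
  have step : ∀ D : T, ∃ E : T, (D : Set Ω) ⊆ E ∧ ∀ F ∈ T, (D : Set Ω) ⊆ F →
      μ.real F - μ.real D ≤ 2 * (μ.real E - μ.real D) := by
    intro D
    let S : Set ℝ := (fun F => μ.real F) '' {F | F ∈ T ∧ (D : Set Ω) ⊆ F}
    have hne : S.Nonempty := ⟨_, D, ⟨D.2, subset_rfl⟩, rfl⟩
    have hbdd : BddAbove S := ⟨c, by rintro _ ⟨F, hF, rfl⟩; exact hF.1.2.2⟩
    have hle : ∀ F ∈ T, (D : Set Ω) ⊆ F → μ.real F ≤ sSup S :=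
      fun F hF hDF => le_csSup hbdd ⟨F, ⟨hF, hDF⟩, rfl⟩
    rcases (hle D D.2 subset_rfl).eq_or_lt with h | h
    · exact ⟨D, subset_rfl, fun F hF hDF => by linarith [hle F hF hDF]⟩
    · obtain ⟨_, ⟨E, hE, rfl⟩, hlt⟩ :=
        exists_lt_of_lt_csSup hne (show (sSup S + μ.real D) / 2 < sSup S by linarith)
      refine ⟨⟨E, hE.1⟩, hE.2, fun F hF hDF => ?_⟩
      have := hle F hF hDF
      simp only at hlt ⊢
      linarith
  choose g hg hgmax using step
  let D : ℕ → T := fun n => g^[n] ⟨B, hBA, hB, hBc⟩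
  have hDs : ∀ n, D (n + 1) = g (D n) := fun n => Function.iterate_succ_apply' g n _
  have hmono : Monotone fun n => (D n : Set Ω) :=
    monotone_nat_of_le_succ fun n => by rw [hDs]; exact hg _
  have hlim : Filter.Tendsto (fun n => μ.real (D n : Set Ω)) Filter.atTop
      (nhds (μ.real (⋃ n, (D n : Set Ω)))) :=
    (ENNReal.tendsto_toReal (measure_ne_top _ _)).comp (tendsto_measure_iUnion_atTop hmono)
  set C : Set Ω := ⋃ n, (D n : Set Ω) with hC
  have hCm : MeasurableSet C := MeasurableSet.iUnion fun n => (D n).2.2.1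
  have hCA : C ⊆ A := Set.iUnion_subset fun n => (D n).2.1
  have hCc : μ.real C ≤ c := le_of_tendsto' hlim fun n => (D n).2.2.2
  refine ⟨C, Set.subset_iUnion (fun n => (D n : Set Ω)) 0, hCA, hCm, ?_⟩
  by_contra hne
  have hlt : μ.real C < c := lt_of_le_of_ne hCc hne
  have hdiff : μ.real (A \ C) = μ.real A - μ.real C := measureReal_sdiff hCA hCm
  obtain ⟨t, htA, ht, ht0, htle⟩ := hμ.exists_small_subset (hA.diff hCm)
    (by linarith) (sub_pos.2 hlt)
  have hun : μ.real (C ∪ t) = μ.real C + μ.real t :=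
    measureReal_union (Set.disjoint_left.2 fun x hx hxt => (htA hxt).2 hx) ht
  have hT : C ∪ t ∈ T :=
    ⟨Set.union_subset hCA (htA.trans Set.sdiff_subset), hCm.union ht, by linarith⟩
  have key : μ.real (C ∪ t) - μ.real C ≤ 2 * (μ.real C - μ.real C) := by
    refine le_of_tendsto_of_tendsto' (tendsto_const_nhds.sub hlim)
      (((hlim.comp (Filter.tendsto_add_atTop_nat 1)).sub hlim).const_mul 2) fun n => ?_
    simp only [Function.comp, hDs]
    exact hgmax (D n) _ hT
      ((Set.subset_iUnion (fun n => (D n : Set Ω)) n).trans Set.subset_union_left)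
  linarith

/-- On a nonatomic finite measure space, an increasing sequence of values is realized by an
increasing sequence of measurable subsets. -/
theorem Nonatomic.exists_monotone_seq {Ω : Type*} [MeasurableSpace Ω] {μ : Measure Ω}
    [IsFiniteMeasure μ] (hμ : Nonatomic μ) {A : Set Ω} (hA : MeasurableSet A) {s : ℕ → ℝ}
    (hs : Monotone s) (hs0 : 0 ≤ s 0) (hsA : ∀ n, s n ≤ μ.real A) :
    ∃ C : ℕ → Set Ω, Monotone C ∧
      ∀ n, C n ⊆ A ∧ MeasurableSet (C n) ∧ μ.real (C n) = s n := by
  let Q : ℕ → Set Ω → Prop := fun n C => C ⊆ A ∧ MeasurableSet C ∧ μ.real C = s n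
  have h0 : ∃ C, Q 0 C := by
    obtain ⟨C, -, h⟩ := hμ.exists_between MeasurableSet.empty hA (Set.empty_subset A)
      (by simpa using hs0) (hsA 0)
    exact ⟨C, h⟩
  have step : ∀ n (C : {C // Q n C}), ∃ E : {E // Q (n + 1) E}, (C : Set Ω) ⊆ E := by
    rintro n ⟨C, hCA, hC, hCs⟩
    obtain ⟨E, hCE, h⟩ := hμ.exists_between hC hA hCA
      (hCs.le.trans (hs n.le_succ)) (hsA (n + 1))
    exact ⟨⟨E, h⟩, hCE⟩
  choose g hg using step
  let D : ∀ n, {C // Q n C} := fun n => Nat.rec ⟨h0.choose, h0.choose_spec⟩ g n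
  exact ⟨fun n => (D n).1, monotone_nat_of_le_succ fun n => hg n (D n), fun n => (D n).2⟩

theorem measureReal_inter_preimage_singleton {Ω : Type*} [MeasurableSpace Ω] {μ : Measure Ω}
    [IsFiniteMeasure μ] {E : Set Ω} (hE : MeasurableSet E) {U : Ω → ℕ} (hU : Measurable U)
    (n : ℕ) :
    μ.real (E ∩ U ⁻¹' {n}) =
      μ.real (E ∩ U ⁻¹' Set.Iio (n + 1)) - μ.real (E ∩ U ⁻¹' Set.Iio n) := by
  have hsplit : E ∩ U ⁻¹' {n} = (E ∩ U ⁻¹' Set.Iio (n + 1)) \ (E ∩ U ⁻¹' Set.Iio n) := by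
    ext ω
    simp only [Set.mem_inter_iff, Set.mem_preimage, Set.mem_singleton_iff, Set.mem_sdiff,
      Set.mem_Iio]
    grind
  have hsub : E ∩ U ⁻¹' Set.Iio n ⊆ E ∩ U ⁻¹' Set.Iio (n + 1) :=
    Set.inter_subset_inter_right _ (Set.preimage_mono (Set.Iio_subset_Iio n.le_succ))
  rw [hsplit, measureReal_sdiff hsub (hE.inter (hU measurableSet_Iio))]

/-- On a nonatomic finite measure space, the restriction of an `ℕ`-valued function to a set can be
copied, in law, on any other set of the same measure. -/
theorem Nonatomic.exists_nat_copy {Ω Ω' : Type*} [MeasurableSpace Ω] [MeasurableSpace Ω']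
    {μ : Measure Ω} {ν : Measure Ω'} [IsFiniteMeasure μ] [IsFiniteMeasure ν] (hν : Nonatomic ν)
    {A : Set Ω} {A' : Set Ω'} (hA : MeasurableSet A) (hA' : MeasurableSet A')
    (hAA' : μ.real A = ν.real A') {W : Ω → ℕ} (hW : Measurable W) :
    ∃ V : Ω' → ℕ, Measurable V ∧
      ∀ n, ν.real (A' ∩ V ⁻¹' {n}) = μ.real (A ∩ W ⁻¹' {n}) := by
  have hmonoW : Monotone fun n => A ∩ W ⁻¹' Set.Iio n := fun m n hmn =>
    Set.inter_subset_inter_right _ (Set.preimage_mono (Set.Iio_subset_Iio hmn))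
  have hunW : ⋃ n, A ∩ W ⁻¹' Set.Iio n = A := by
    ext ω
    simp only [Set.mem_iUnion, Set.mem_inter_iff, Set.mem_preimage, Set.mem_Iio]
    exact ⟨fun ⟨_, h⟩ => h.1, fun h => ⟨W ω + 1, h, Nat.lt_succ_self _⟩⟩
  obtain ⟨C, hCmono, hC⟩ := hν.exists_monotone_seq hA'
    (s := fun n => μ.real (A ∩ W ⁻¹' Set.Iio n))
    (fun m n hmn => measureReal_mono (hmonoW hmn)) measureReal_nonneg
    (fun n => hAA' ▸ measureReal_mono Set.inter_subset_left)
  have hCm : MeasurableSet (⋃ n, C n) := MeasurableSet.iUnion fun n => (hC n).2.1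
  have hCA : ⋃ n, C n ⊆ A' := Set.iUnion_subset fun n => (hC n).1
  have hlim : ν.real (⋃ n, C n) = ν.real A' := by
    have h1 : Filter.Tendsto (fun n => ν.real (C n)) Filter.atTop (nhds (ν.real (⋃ n, C n))) :=
      (ENNReal.tendsto_toReal (measure_ne_top _ _)).comp (tendsto_measure_iUnion_atTop hCmono)
    have h2 : Filter.Tendsto (fun n => μ.real (A ∩ W ⁻¹' Set.Iio n)) Filter.atTop
        (nhds (μ.real (⋃ n, A ∩ W ⁻¹' Set.Iio n))) :=
      (ENNReal.tendsto_toReal (measure_ne_top _ _)).comp (tendsto_measure_iUnion_atTop hmonoW)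
    rw [hunW, hAA'] at h2
    exact tendsto_nhds_unique h1 (by simpa only [(hC _).2.2] using h2)
  have hnull : ν.real (A' \ ⋃ n, C n) = 0 := by
    rw [measureReal_sdiff hCA hCm, hlim, sub_self]
  have hex : ∀ ω, ∃ n, ω ∈ C (n + 1) ∪ (⋃ n, C n)ᶜ := by
    intro ω
    by_cases h : ω ∈ ⋃ n, C n
    · obtain ⟨n, hn⟩ := Set.mem_iUnion.1 h
      exact ⟨n, Or.inl (hCmono n.le_succ hn)⟩
    · exact ⟨0, Or.inr h⟩
  classical
  let V : Ω' → ℕ := fun ω => Nat.find (hex ω)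
  have hV : Measurable V := measurable_find hex fun n => (hC (n + 1)).2.1.union hCm.compl
  have hle : ∀ n, A' ∩ V ⁻¹' Set.Iio (n + 1) = C (n + 1) ∪ (A' \ ⋃ n, C n) := by
    intro n
    ext ω
    have hiff : V ω < n + 1 ↔ ω ∈ C (n + 1) ∪ (⋃ n, C n)ᶜ := by
      rw [Nat.lt_succ_iff, Nat.find_le_iff]
      refine ⟨fun ⟨m, hmn, hm⟩ => ?_, fun h => ⟨n, le_rfl, h⟩⟩
      exact hm.imp (fun h => hCmono (Nat.succ_le_succ hmn) h) id
    simp only [Set.mem_inter_iff, Set.mem_preimage, Set.mem_Iio, hiff, Set.mem_union,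
      Set.mem_compl_iff, Set.mem_sdiff]
    have := @(hC (n + 1)).1 ω
    tauto
  have hlt : ∀ n, ν.real (A' ∩ V ⁻¹' Set.Iio n) = μ.real (A ∩ W ⁻¹' Set.Iio n) := by
    rintro (_ | n)
    · simp
    · rw [hle, ← (hC (n + 1)).2.2]
      refine le_antisymm ((measureReal_union_le _ _).trans (by rw [hnull, add_zero])) ?_
      exact measureReal_mono Set.subset_union_left
  refine ⟨V, hV, fun n => ?_⟩
  rw [measureReal_inter_preimage_singleton hA' hV, measureReal_inter_preimage_singleton hA hW,
    hlt, hlt]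

/-- On a nonatomic probability space, for `ℕ`-valued `K ∼ K'` every `ℕ`-valued `W` has a
counterpart `W'` with `(W', K') ∼ (W, K)`. -/
theorem Nonatomic.exists_identDistrib_prodMk {Ω Ω' : Type*} [MeasurableSpace Ω]
    [MeasurableSpace Ω'] {μ : Measure Ω} {ν : Measure Ω'} [IsFiniteMeasure μ] [IsFiniteMeasure ν]
    (hν : Nonatomic ν) {K W : Ω → ℕ} {K' : Ω' → ℕ} (hK : Measurable K) (hW : Measurable W)
    (hK' : Measurable K') (hKK' : IdentDistrib K K' μ ν) :
    ∃ W' : Ω' → ℕ, Measurable W' ∧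
      IdentDistrib (fun ω => (W ω, K ω)) (fun ω => (W' ω, K' ω)) μ ν := by
  have hcopy : ∀ k, ∃ V : Ω' → ℕ, Measurable V ∧
      ∀ n, ν.real (K' ⁻¹' {k} ∩ V ⁻¹' {n}) = μ.real (K ⁻¹' {k} ∩ W ⁻¹' {n}) := fun k =>
    hν.exists_nat_copy (hK (measurableSet_singleton k)) (hK' (measurableSet_singleton k))
      (congrArg ENNReal.toReal (hKK'.measure_mem_eq (measurableSet_singleton k))) hW
  choose V hVm hV using hcopy
  have hW' : Measurable fun ω => V (K' ω) ω :=
    (measurable_from_prod_countable_right (f := fun q : ℕ × Ω' => V q.1 q.2) hVm).comp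
      (hK'.prodMk measurable_id)
  refine ⟨fun ω => V (K' ω) ω, hW', (hW.prodMk hK).aemeasurable, (hW'.prodMk hK').aemeasurable, ?_⟩
  refine Measure.ext_of_singleton fun ⟨n, k⟩ => ?_
  rw [Measure.map_apply (hW.prodMk hK) (measurableSet_singleton _),
    Measure.map_apply (hW'.prodMk hK') (measurableSet_singleton _)]
  have h1 : (fun ω => (W ω, K ω)) ⁻¹' {(n, k)} = K ⁻¹' {k} ∩ W ⁻¹' {n} := by
    ext ω
    simp [and_comm]
  have h2 : (fun ω => (V (K' ω) ω, K' ω)) ⁻¹' {(n, k)} = K' ⁻¹' {k} ∩ V k ⁻¹' {n} := by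
    ext ω
    simp only [Set.mem_preimage, Set.mem_singleton_iff, Prod.mk.injEq, Set.mem_inter_iff]
    grind
  rw [h1, h2]
  exact ((ENNReal.toReal_eq_toReal_iff' (measure_ne_top _ _) (measure_ne_top _ _)).1 (hV k n)).symm

/-- Given `0 ≤ Z ≤ X` and `X ∼ X'`, up to an error `ε` in norm `Z` has the same law as some `Z'`
with `0 ≤ Z' ≤ X'`. -/
theorem Nonatomic.exists_approx_identDistrib {Ω : Type*} [MeasurableSpace Ω] {P : Measure Ω}
    [IsProbabilityMeasure P] (hP : Nonatomic P) {p : ℝ≥0∞} {X X' Z : Lp ℝ p P} (hX' : 0 ≤ X')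
    (hXX' : IdentDistrib (X : Ω → ℝ) (X' : Ω → ℝ) P P) (hZ : 0 ≤ Z) (hZX : Z ≤ X)
    {ε : ℝ} (hε : 0 < ε) :
    ∃ Y Z' : Lp ℝ p P, ‖Z - Y‖ ≤ ε ∧ IdentDistrib (Y : Ω → ℝ) (Z' : Ω → ℝ) P P ∧
      0 ≤ Z' ∧ Z' ≤ X' := by
  have hfloor : Measurable fun x : ℝ => ⌊x / ε⌋₊ :=
    Nat.measurable_floor.comp (measurable_id.div_const ε)
  have hm : ∀ f : Lp ℝ p P, Measurable (f : Ω → ℝ) := fun f => (Lp.stronglyMeasurable f).measurable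
  have hlow : ∀ x : ℝ, 0 ≤ x → ε * (⌊x / ε⌋₊ : ℝ) ≤ x := fun x hx => by
    have := Nat.floor_le (div_nonneg hx hε.le)
    rw [le_div_iff₀ hε] at this
    linarith
  have hup : ∀ x : ℝ, x ≤ ε * (⌊x / ε⌋₊ : ℝ) + ε := fun x => by
    have := (Nat.lt_floor_add_one (x / ε)).le
    rw [div_le_iff₀ hε] at this
    linarith
  have hZ0 := (Lp.coeFn_nonneg Z).2 hZ
  have hX0' := (Lp.coeFn_nonneg X').2 hX'
  have hZX0 := (Lp.coeFn_le Z X).2 hZX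
  obtain ⟨W', hW', hid⟩ := hP.exists_identDistrib_prodMk (hfloor.comp (hm X)) (hfloor.comp (hm Z))
    (hfloor.comp (hm X')) (hXX'.comp hfloor)
  have hWK : ∀ᵐ ω ∂P, W' ω ≤ ⌊X' ω / ε⌋₊ := by
    refine hid.ae_snd (p := fun q : ℕ × ℕ => q.1 ≤ q.2) (Set.to_countable _).measurableSet ?_
    filter_upwards [hZX0] with ω h
    exact Nat.floor_le_floor (by gcongr)
  have hscale : Measurable fun n : ℕ => ε * (n : ℝ) := measurable_of_countable _
  have hYmem : MemLp (fun ω => ε * (⌊Z ω / ε⌋₊ : ℝ)) p P := by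
    refine (Lp.memLp Z).mono (hscale.comp (hfloor.comp (hm Z))).aestronglyMeasurable ?_
    filter_upwards [hZ0] with ω h
    rw [Real.norm_of_nonneg (by positivity), Real.norm_of_nonneg h]
    exact hlow _ h
  have hle' : ∀ᵐ ω ∂P, ε * (W' ω : ℝ) ≤ X' ω := by
    filter_upwards [hWK, hX0'] with ω h h0
    refine le_trans ?_ (hlow _ h0)
    gcongr
  have hZmem : MemLp (fun ω => ε * (W' ω : ℝ)) p P := by
    refine (Lp.memLp X').mono (hscale.comp hW').aestronglyMeasurable ?_
    filter_upwards [hle', hX0'] with ω h h0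
    rwa [Real.norm_of_nonneg (by positivity), Real.norm_of_nonneg h0]
  refine ⟨hYmem.toLp, hZmem.toLp, ?_, ?_, ?_, ?_⟩
  · refine (Lp.norm_le_of_ae_bound hε.le (C := ε) ?_).trans ?_
    · filter_upwards [Lp.coeFn_sub Z hYmem.toLp, hYmem.coeFn_toLp, hZ0] with ω h1 h2 h3
      rw [h1, Pi.sub_apply, h2, Real.norm_eq_abs, abs_le]
      constructor <;> linarith [hlow _ h3, hup (Z ω)]
    · simp [measureUnivNNReal]
  · have h : IdentDistrib (fun ω => ε * (⌊Z ω / ε⌋₊ : ℝ)) (fun ω => ε * (W' ω : ℝ)) P P :=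
      hid.comp (u := fun q : ℕ × ℕ => ε * (q.1 : ℝ)) (measurable_of_countable _)
    exact (IdentDistrib.of_ae_eq (hm _).aemeasurable hYmem.coeFn_toLp).trans
      (h.trans (IdentDistrib.of_ae_eq (hm _).aemeasurable hZmem.coeFn_toLp).symm)
  · rw [← Lp.coeFn_nonneg]
    filter_upwards [hZmem.coeFn_toLp] with ω h
    rw [h]
    exact mul_nonneg hε.le (Nat.cast_nonneg _)
  · rw [← Lp.coeFn_le]
    filter_upwards [hZmem.coeFn_toLp, hle'] with ω h h'
    rwa [h]

/-- The positive part `ρ⁺(X) = sup {ρ(Z) : 0 ≤ Z ≤ X}` of a law-invariant bounded linear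
functional on `L^p` is law invariant on nonnegative elements. -/
theorem lawInvariant_pos_part
    {Ω : Type*} [MeasurableSpace Ω] (P : Measure Ω) [IsProbabilityMeasure P]
    (hP : Nonatomic P) (p : ℝ≥0∞) [Fact (1 ≤ p)]
    (ρ : Lp ℝ p P →L[ℝ] ℝ)
    (hρ : ∀ X X' : Lp ℝ p P, IdentDistrib (X : Ω → ℝ) (X' : Ω → ℝ) P P → ρ X = ρ X')
    (X X' : Lp ℝ p P) (hX : 0 ≤ X) (hX' : 0 ≤ X')
    (hXX' : IdentDistrib (X : Ω → ℝ) (X' : Ω → ℝ) P P) :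
    sSup {r : ℝ | ∃ Z : Lp ℝ p P, 0 ≤ Z ∧ Z ≤ X ∧ ρ Z = r} =
      sSup {r : ℝ | ∃ Z : Lp ℝ p P, 0 ≤ Z ∧ Z ≤ X' ∧ ρ Z = r} := by
  have hbdd : ∀ U : Lp ℝ p P, BddAbove {r : ℝ | ∃ Z : Lp ℝ p P, 0 ≤ Z ∧ Z ≤ U ∧ ρ Z = r} := by
    refine fun U => ⟨‖ρ‖ * ‖U‖, ?_⟩
    rintro _ ⟨Z, hZ, hZU, rfl⟩
    have hnorm : ‖Z‖ ≤ ‖U‖ := by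
      refine Lp.norm_le_norm_of_ae_le ?_
      filter_upwards [(Lp.coeFn_nonneg Z).2 hZ, (Lp.coeFn_le Z U).2 hZU] with ω h0 h1
      exact abs_le_abs_of_nonneg h0 h1
    exact (le_abs_self _).trans ((ρ.le_opNorm Z).trans (by gcongr))
  have hle : ∀ U U' : Lp ℝ p P, 0 ≤ U → 0 ≤ U' → IdentDistrib (U : Ω → ℝ) (U' : Ω → ℝ) P P →
      sSup {r : ℝ | ∃ Z : Lp ℝ p P, 0 ≤ Z ∧ Z ≤ U ∧ ρ Z = r} ≤
        sSup {r : ℝ | ∃ Z : Lp ℝ p P, 0 ≤ Z ∧ Z ≤ U' ∧ ρ Z = r} := by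
    intro U U' hU hU' hUU'
    refine csSup_le ⟨ρ 0, 0, le_rfl, hU, rfl⟩ ?_
    rintro _ ⟨Z, hZ, hZU, rfl⟩
    refine le_of_forall_pos_le_add fun δ hδ => ?_
    have hpos : 0 < ‖ρ‖ + 1 := by positivity
    obtain ⟨Y, Z', hY, hYZ, hZ', hZU'⟩ :=
      hP.exists_approx_identDistrib hU' hUU' hZ hZU (div_pos hδ hpos)
    have h1 : ρ Z' ≤ sSup {r : ℝ | ∃ Z : Lp ℝ p P, 0 ≤ Z ∧ Z ≤ U' ∧ ρ Z = r} :=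
      le_csSup (hbdd U') ⟨Z', hZ', hZU', rfl⟩
    have h2 : ρ Z - ρ Y ≤ δ := by
      rw [← map_sub]
      calc ρ (Z - Y) ≤ ‖ρ‖ * ‖Z - Y‖ := (le_abs_self _).trans (ρ.le_opNorm _)
        _ ≤ (‖ρ‖ + 1) * (δ / (‖ρ‖ + 1)) := by gcongr; linarith
        _ = δ := mul_div_cancel₀ δ hpos.ne'
    linarith [hρ Y Z' hYZ]
  exact le_antisymm (hle X X' hX hX' hXX') (hle X' X hX' hX hXX'.symm)
end

section
/- Let μ be Lebesgue measure on [0,1] and let N be as defined below. Let m, n ≥ 1 be natural numbers and ε > 0. Suppose Y, Z, U₁, …, U_m, V₁, …, V_m are nonnegative integrable functions on [0,1] such that N(Z) < ε, U_i ~ V_i for i = 1, …, m, and U := Σ_{i=1}^m U_i satisfies U ≥ Y − Z + Σ_{i=1}^m V_i almost everywhere. Then for every measurable set A ⊆ [0,1] with μ(A) ≤ 1/((m+1)·2^n·n!), there exists a measurable set A' ⊇ A with μ(A') ≤ (m+1)·μ(A) such that ∫_{A'} U dμ − ∫_A U dμ ≥ ∫_A Y dμ − ε/(n·2^n). -/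
open MeasureTheory ProbabilityTheory
open scoped ENNReal

/-- Lebesgue measure on `[0,1]`. -/
noncomputable def μ01 : Measure ℝ := volume.restrict (Set.Icc (0 : ℝ) 1)

/-- The rearrangement-invariant norm
`N(f) = sup_{n ≥ 1} n·2ⁿ · sup {∫_A |f| dμ : A ⊆ [0,1] measurable, μ(A) ≤ 1/(2ⁿ·n!)}`. -/
noncomputable def Nnorm (f : ℝ → ℝ) : ℝ≥0∞ :=
  ⨆ (n : ℕ) (_ : 1 ≤ n),
    ((n : ℝ≥0∞) * 2 ^ n) *
      ⨆ (A : Set ℝ) (_ : MeasurableSet A) (_ : A ⊆ Set.Icc (0 : ℝ) 1)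
        (_ : μ01 A ≤ 1 / ((2 : ℝ≥0∞) ^ n * (Nat.factorial n : ℝ≥0∞))),
        ∫⁻ t in A, ENNReal.ofReal |f t| ∂μ01

open Set Filter Topology in
/-- A finite measure without atoms on the line takes all intermediate values on the measurable
subsets of a measurable set. -/
theorem exists_measurableSet_subset_measureReal_eq {μ : Measure ℝ} [IsFiniteMeasure μ]
    [NullSingletonClass μ] {E : Set ℝ} (hE : MeasurableSet E) {c : ℝ} (hc0 : 0 ≤ c)
    (hc : c ≤ μ.real E) :
    ∃ F ⊆ E, MeasurableSet F ∧ μ.real F = c := by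
  rcases hc0.eq_or_lt with rfl | hc0
  · exact ⟨∅, empty_subset _, .empty, by simp⟩
  rcases hc.eq_or_lt with rfl | hc
  · exact ⟨E, subset_rfl, hE, rfl⟩
  set ν := μ.restrict E with hν
  have hcont : Continuous fun x => ν.real (Iic x) := by
    have h1 : ∀ x, ν.real (Iic x) = (∫ _ in (0 : ℝ)..x, (1 : ℝ) ∂ν) + ν.real (Iic 0) := by
      intro x
      have := intervalIntegral.integral_Iic_sub_Iic (μ := ν) (f := fun _ => (1 : ℝ)) (a := 0)
        (b := x) (integrable_const _).integrableOn (integrable_const _).integrableOn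
      rw [← this]
      simp
    rw [funext h1]
    exact ((integrable_const (1 : ℝ)).continuous_primitive 0).add continuous_const
  have htop : Tendsto (fun x => ν.real (Iic x)) atTop (𝓝 (μ.real E)) := by
    have h := (ENNReal.tendsto_toReal (measure_ne_top ν univ)).comp (tendsto_measure_Iic_atTop ν)
    simpa [hν, Function.comp_def, Measure.real] using h
  have hbot : Tendsto (fun x => ν.real (Iic x)) atBot (𝓝 0) := by
    have h := tendsto_measure_iInter_atBot (μ := ν) (s := fun x : ℝ => Iic x)
      (fun _ => measurableSet_Iic.nullMeasurableSet) (fun _ _ h => Iic_subset_Iic.2 h)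
      ⟨0, measure_ne_top _ _⟩
    have h' := (ENNReal.tendsto_toReal (measure_ne_top ν _)).comp h
    have he : ⋂ x : ℝ, Iic x = ∅ := iInter_Iic_eq_empty_iff.2 (by simp)
    simpa [he, Function.comp_def, Measure.real] using h'
  obtain ⟨x, hx⟩ := mem_range_of_exists_le_of_exists_ge hcont
    ((hbot.eventually (eventually_le_nhds hc0)).exists)
    ((htop.eventually (eventually_ge_nhds hc)).exists)
  refine ⟨Iic x ∩ E, inter_subset_right, measurableSet_Iic.inter hE, ?_⟩
  rw [← hx]
  exact (measureReal_restrict_apply measurableSet_Iic).symm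

open Set Filter Topology in
/-- Existence of an upper quantile, truncated at `0`. -/
theorem exists_upper_quantile {Ω : Type*} [MeasurableSpace Ω] {μ : Measure Ω} [IsFiniteMeasure μ]
    {V : Ω → ℝ} (hV : Measurable V) {c : ℝ} (hc : 0 < c) :
    ∃ s, 0 ≤ s ∧ μ.real {x | s < V x} ≤ c ∧ (s = 0 ∨ c ≤ μ.real {x | s ≤ V x}) := by
  set S : Set ℝ := {s | 0 ≤ s ∧ μ.real {x | s < V x} ≤ c} with hS
  have hmeas : ∀ s, MeasurableSet {x | s < V x} := fun s => measurableSet_lt measurable_const hV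
  have hbdd : BddBelow S := ⟨0, fun s hs => hs.1⟩
  have hne : S.Nonempty := by
    have h := tendsto_measure_iInter_atTop (μ := μ) (s := fun s : ℝ => {x | s < V x})
      (fun s => (hmeas s).nullMeasurableSet) (fun a b hab x hx => lt_of_le_of_lt hab hx)
      ⟨0, measure_ne_top _ _⟩
    have he : ⋂ s : ℝ, {x | s < V x} = ∅ := by
      ext x
      simpa using ⟨V x, le_rfl⟩
    have h' := (ENNReal.tendsto_toReal (measure_ne_top μ _)).comp h
    rw [he] at h'
    obtain ⟨s, hs, hs0⟩ := ((h'.eventually (eventually_le_nhds (b := c) (by simpa using hc))).and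
      (eventually_ge_atTop 0)).exists
    exact ⟨s, hs0, hs⟩
  refine ⟨sInf S, le_csInf hne fun s hs => hs.1, ?_, ?_⟩
  · obtain ⟨u, hu, hus, hut⟩ := exists_seq_strictAnti_tendsto (sInf S)
    have h := tendsto_measure_iUnion_atTop (μ := μ) (s := fun n => {x | u n < V x})
      (fun a b hab x hx => lt_of_le_of_lt (hu.antitone hab) hx)
    have he : ⋃ n, {x | u n < V x} = {x | sInf S < V x} := by
      ext x
      simp only [mem_iUnion, mem_ofPred_eq]
      exact ⟨fun ⟨n, hn⟩ => (hus n).trans hn,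
        fun hx => (hut.eventually (eventually_lt_nhds hx)).exists⟩
    rw [he] at h
    have h' := (ENNReal.tendsto_toReal (measure_ne_top μ _)).comp h
    refine le_of_tendsto' h' fun n => ?_
    obtain ⟨t, ht, htu⟩ := exists_lt_of_csInf_lt hne (hus n)
    exact (measureReal_mono fun x hx => htu.trans hx).trans ht.2
  · rcases (le_csInf hne fun s hs => hs.1 : 0 ≤ sInf S).eq_or_lt with h0 | h0
    · exact .inl h0.symm
    right
    obtain ⟨u, hu, hus, hut⟩ := exists_seq_strictMono_tendsto' h0
    have h := tendsto_measure_iInter_atTop (μ := μ) (s := fun n => {x | u n < V x})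
      (fun n => (hmeas _).nullMeasurableSet)
      (fun a b hab x hx => lt_of_le_of_lt (hu.monotone hab) hx) ⟨0, measure_ne_top _ _⟩
    have he : ⋂ n, {x | u n < V x} = {x | sInf S ≤ V x} := by
      ext x
      simp only [mem_iInter, mem_ofPred_eq]
      exact ⟨fun hx => le_of_tendsto' hut fun n => (hx n).le, fun hx n => (hus n).2.trans_le hx⟩
    rw [he] at h
    have h' := (ENNReal.tendsto_toReal (measure_ne_top μ _)).comp h
    refine ge_of_tendsto' h' fun n => ?_
    by_contra! hlt
    exact (hus n).2.not_ge (csInf_le hbdd ⟨(hus n).1.le, hlt.le⟩)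

/-- On an atomless measure space, the integral of a nonnegative function over a given set can be
matched by an equidistributed function over a set that is not larger. -/
theorem exists_setIntegral_le_of_identDistrib {Ω : Type*} [MeasurableSpace Ω] {P : Measure Ω}
    {μ : Measure ℝ} [IsFiniteMeasure P] [IsFiniteMeasure μ] [NullSingletonClass μ] {U : Ω → ℝ}
    {V : ℝ → ℝ} (hU : Integrable U P) (hV0 : ∀ᵐ t ∂μ, 0 ≤ V t)
    (hUV : IdentDistrib U V P μ) (A : Set Ω) :
    ∃ B : Set ℝ, MeasurableSet B ∧ μ B ≤ P A ∧ ∫ t in A, U t ∂P ≤ ∫ t in B, V t ∂μ := by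
  wlog hVm : Measurable V generalizing V
  · have hVa := hUV.aemeasurable_snd
    obtain ⟨B, hB, hBA, h⟩ := this (V := hVa.mk V)
      (by filter_upwards [hVa.ae_eq_mk, hV0] with t h1 h2; rwa [← h1])
      (hUV.trans hVa.identDistrib_mk) hVa.measurable_mk
    refine ⟨B, hB, hBA, h.trans_eq ?_⟩
    exact setIntegral_congr_ae hB (by filter_upwards [hVa.ae_eq_mk] with t h1 _ using h1.symm)
  have hV : Integrable V μ := hUV.integrable_snd hU
  rcases eq_or_ne (P A) 0 with hA0 | hA0
  · exact ⟨∅, .empty, by simp, by simp [Measure.restrict_eq_zero.2 hA0]⟩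
  have hc : 0 < P.real A := ENNReal.toReal_pos hA0 (measure_ne_top _ _)
  obtain ⟨s, hs0, hs1, hs2⟩ := exists_upper_quantile (μ := μ) hVm hc
  have hgt : MeasurableSet {t | s < V t} := measurableSet_lt measurable_const hVm
  obtain ⟨B, hB, hBle, hsub, hsup, hsB⟩ : ∃ B, MeasurableSet B ∧ μ.real B ≤ P.real A ∧
      {t | s < V t} ⊆ B ∧ B ⊆ {t | s ≤ V t} ∧ s * μ.real B = s * P.real A := by
    rcases hs2 with rfl | hs2
    · exact ⟨_, hgt, hs1, subset_rfl, fun t (ht : 0 < V t) => ht.le, by simp⟩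
    have hge : MeasurableSet {t | s ≤ V t} := measurableSet_le measurable_const hVm
    have hss : {t | s < V t} ⊆ {t | s ≤ V t} := fun t (ht : s < V t) => ht.le
    obtain ⟨F, hFE, hF, hFc⟩ := exists_measurableSet_subset_measureReal_eq (μ := μ)
      (hge.diff hgt) (c := P.real A - μ.real {t | s < V t}) (by linarith)
      (by rw [measureReal_sdiff hss hgt]; linarith)
    have hBm : μ.real ({t | s < V t} ∪ F) = P.real A := by
      rw [measureReal_union (Set.disjoint_left.2 fun t ht htF => (hFE htF).2 ht) hF, hFc]
      ring
    exact ⟨_, hgt.union hF, hBm.le, Set.subset_union_left,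
      Set.union_subset hss fun t ht => (hFE ht).1, by rw [hBm]⟩
  refine ⟨B, hB, (ENNReal.toReal_le_toReal (measure_ne_top _ _) (measure_ne_top _ _)).1 hBle, ?_⟩
  have hUs : Integrable (fun t => U t - s) P := hU.sub (integrable_const s)
  have hVs : Integrable (fun t => V t - s) μ := hV.sub (integrable_const s)
  have hpos : ∫ t, max (U t - s) 0 ∂P = ∫ t, max (V t - s) 0 ∂μ :=
    (hUV.comp (u := fun x : ℝ => max (x - s) 0) (by fun_prop)).integral_eq
  have hA1 : ∫ t in A, (U t - s) ∂P ≤ ∫ t, max (U t - s) 0 ∂P :=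
    (setIntegral_mono hUs.integrableOn hUs.pos_part.integrableOn fun t => le_max_left _ _).trans
      (setIntegral_le_integral hUs.pos_part (.of_forall fun t => le_max_right _ _))
  have hB1 : ∫ t, max (V t - s) 0 ∂μ = ∫ t in B, (V t - s) ∂μ := by
    rw [← integral_indicator hB]
    congr 1 with t
    by_cases ht : t ∈ B
    · simpa [ht] using hsup ht
    · have : V t ≤ s := not_lt.1 fun h => ht (hsub h)
      simpa [ht] using this
  rw [integral_sub hU.integrableOn (integrable_const s).integrableOn] at hA1
  rw [integral_sub hV.integrableOn (integrable_const s).integrableOn] at hB1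
  simp only [setIntegral_const, smul_eq_mul] at hA1 hB1
  linarith

instance isFiniteMeasure_μ01 : IsFiniteMeasure μ01 := by
  unfold μ01; infer_instance

instance nullSingletonClass_μ01 : NullSingletonClass μ01 := by
  unfold μ01; infer_instance

/-- The defining bound of `Nnorm` on small sets. -/
theorem setIntegral_abs_le_of_Nnorm_lt {n : ℕ} (hn : 1 ≤ n) {ε : ℝ} (hε : 0 < ε) {Z : ℝ → ℝ}
    (hZ : Integrable Z μ01) (hNZ : Nnorm Z < ENNReal.ofReal ε) {A : Set ℝ} (hA : MeasurableSet A)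
    (hA1 : A ⊆ Set.Icc (0 : ℝ) 1)
    (hPA : μ01 A ≤ 1 / ((2 : ℝ≥0∞) ^ n * (Nat.factorial n : ℝ≥0∞))) :
    ∫ t in A, |Z t| ∂μ01 ≤ ε / (n * 2 ^ n) := by
  have h1 : ((n : ℝ≥0∞) * 2 ^ n) * ∫⁻ t in A, ENNReal.ofReal |Z t| ∂μ01 ≤ ENNReal.ofReal ε := by
    refine le_trans ?_ hNZ.le
    refine le_iSup₂_of_le n hn (mul_le_mul_right ?_ _)
    exact le_iSup₂_of_le A hA (le_iSup₂_of_le hA1 hPA le_rfl)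
  rw [← ofReal_integral_eq_lintegral_ofReal hZ.abs.integrableOn
    (.of_forall fun t => abs_nonneg (Z t))] at h1
  have h2 : (n : ℝ≥0∞) * 2 ^ n = ENNReal.ofReal (n * 2 ^ n) := by
    rw [ENNReal.ofReal_mul (by positivity), ENNReal.ofReal_pow (by positivity)]
    simp
  rw [h2, ← ENNReal.ofReal_mul (by positivity), ENNReal.ofReal_le_ofReal_iff hε.le] at h1
  rw [le_div_iff₀ (by positivity)]
  linarith

/-- Lemma 4.1 of the paper: a one-step mass-transfer estimate. -/
theorem one_step_estimate
    (m n : ℕ) (hm : 1 ≤ m) (hn : 1 ≤ n) (ε : ℝ) (hε : 0 < ε)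
    (Y Z : ℝ → ℝ) (U V : Fin m → ℝ → ℝ)
    (hY : Integrable Y μ01) (hY0 : ∀ᵐ t ∂μ01, 0 ≤ Y t)
    (hZ : Integrable Z μ01) (hZ0 : ∀ᵐ t ∂μ01, 0 ≤ Z t)
    (hU : ∀ i, Integrable (U i) μ01) (hU0 : ∀ i, ∀ᵐ t ∂μ01, 0 ≤ U i t)
    (hV : ∀ i, Integrable (V i) μ01) (hV0 : ∀ i, ∀ᵐ t ∂μ01, 0 ≤ V i t)
    (hNZ : Nnorm Z < ENNReal.ofReal ε)
    (hUV : ∀ i, IdentDistrib (U i) (V i) μ01 μ01)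
    (hdom : ∀ᵐ t ∂μ01, Y t - Z t + ∑ i, V i t ≤ ∑ i, U i t)
    (A : Set ℝ) (hA : MeasurableSet A) (hA1 : A ⊆ Set.Icc (0 : ℝ) 1)
    (hPA : μ01 A ≤ 1 / (((m : ℝ≥0∞) + 1) * 2 ^ n * (Nat.factorial n : ℝ≥0∞))) :
    ∃ A' : Set ℝ, MeasurableSet A' ∧ A ⊆ A' ∧
      μ01 A' ≤ ((m : ℝ≥0∞) + 1) * μ01 A ∧
      (∫ t in A, Y t ∂μ01) - ε / (n * 2 ^ n) ≤
        (∫ t in A', ∑ i, U i t ∂μ01) - ∫ t in A, ∑ i, U i t ∂μ01 := by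
  choose B hB hBA hUB using fun i =>
    exists_setIntegral_le_of_identDistrib (hU i) (hV0 i) (hUV i) A
  set C : Fin m → Set ℝ := fun i => B i ∩ Set.Icc 0 1
  have hC : ∀ i, MeasurableSet (C i) := fun i => (hB i).inter measurableSet_Icc
  have hUC : ∀ i, ∫ t in A, U i t ∂μ01 ≤ ∫ t in C i, V i t ∂μ01 := by
    refine fun i => (hUB i).trans_eq ?_
    simp only [μ01, C, Measure.restrict_restrict (hB i), Measure.restrict_restrict (hC i),
      Set.inter_assoc, Set.inter_self]
  set A' : Set ℝ := A ∪ ⋃ i, C i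
  have hA' : MeasurableSet A' := hA.union (.iUnion hC)
  have hAA' : A ⊆ A' := Set.subset_union_left
  have hCA' : ∀ i, C i ⊆ A' := fun i => (Set.subset_iUnion C i).trans Set.subset_union_right
  have hA'1 : A' ⊆ Set.Icc 0 1 :=
    Set.union_subset hA1 (Set.iUnion_subset fun i => Set.inter_subset_right)
  have hμA' : μ01 A' ≤ ((m : ℝ≥0∞) + 1) * μ01 A := by
    calc μ01 A' ≤ μ01 A + ∑ i, μ01 (C i) :=
          (measure_union_le _ _).trans (by gcongr; exact measure_iUnion_fintype_le _ _)
      _ ≤ μ01 A + ∑ _i : Fin m, μ01 A := by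
          gcongr _ + ?_
          exact Finset.sum_le_sum fun i _ => (measure_mono Set.inter_subset_left).trans (hBA i)
      _ = ((m : ℝ≥0∞) + 1) * μ01 A := by
          simp
          ring
  refine ⟨A', hA', hAA', hμA', ?_⟩
  have hZA' : ∫ t in A', |Z t| ∂μ01 ≤ ε / (n * 2 ^ n) := by
    refine setIntegral_abs_le_of_Nnorm_lt hn hε hZ hNZ hA' hA'1 (hμA'.trans ?_)
    calc ((m : ℝ≥0∞) + 1) * μ01 A
        ≤ ((m : ℝ≥0∞) + 1) * (1 / (((m : ℝ≥0∞) + 1) * 2 ^ n * (Nat.factorial n : ℝ≥0∞))) := by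
          gcongr
      _ = 1 / ((2 : ℝ≥0∞) ^ n * (Nat.factorial n : ℝ≥0∞)) := by
          rw [mul_assoc, ← mul_div_assoc, ENNReal.mul_div_mul_left _ _ (by simp) (by finiteness)]
  have hZle : ∫ t in A', Z t ∂μ01 ≤ ∫ t in A', |Z t| ∂μ01 :=
    setIntegral_mono hZ.integrableOn hZ.abs.integrableOn fun t => le_abs_self _
  have hYle : ∫ t in A, Y t ∂μ01 ≤ ∫ t in A', Y t ∂μ01 :=
    setIntegral_mono_set hY.integrableOn (ae_restrict_of_ae hY0) hAA'.eventuallyLE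
  have hVle : ∫ t in A, ∑ i, U i t ∂μ01 ≤ ∫ t in A', ∑ i, V i t ∂μ01 := by
    rw [integral_finsetSum _ fun i _ => (hU i).integrableOn,
      integral_finsetSum _ fun i _ => (hV i).integrableOn]
    exact Finset.sum_le_sum fun i _ => (hUC i).trans
      (setIntegral_mono_set (hV i).integrableOn (ae_restrict_of_ae (hV0 i)) (hCA' i).eventuallyLE)
  have hVint : Integrable (fun t => ∑ i, V i t) μ01 := integrable_finsetSum _ fun i _ => hV i
  have hUint : Integrable (fun t => ∑ i, U i t) μ01 := integrable_finsetSum _ fun i _ => hU i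
  have hYZ : Integrable (fun t => Y t - Z t) μ01 := hY.sub hZ
  have hle : ∫ t in A', (Y t - Z t + ∑ i, V i t) ∂μ01 ≤ ∫ t in A', ∑ i, U i t ∂μ01 :=
    integral_mono_ae (hYZ.add hVint).integrableOn hUint.integrableOn
      (ae_restrict_of_ae hdom)
  rw [integral_add hYZ.integrableOn hVint.integrableOn,
    integral_sub hY.integrableOn hZ.integrableOn] at hle
  linarith
end

section
/- Let μ be Lebesgue measure on [0,1] and let N be as defined below. Let c_n = 1/(2^n·(n+1)!), Y = Σ_{n=3}^∞ n!·1_{[c_{n+1}, c_n)}, and X = Y − (∫_0^1 Y dμ)·1. Then for every natural number m and all integrable functions U₁, …, U_m, V₁, …, V_m on [0,1] with N(U_i) < ∞, N(V_i) < ∞ and U_i ~ V_i for each i, one has N( X − Σ_{i=1}^m (U_i − V_i) ) ≥ 1/8. (Consequently, X has mean zero but does not belong to the closure, in the norm N, of the span of differences of identically distributed functions; so on this rearrangement-invariant space some law-invariant bounded linear functional fails to be a scalar multiple of the expectation.) -/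
open MeasureTheory ProbabilityTheory
open scoped ENNReal

/-- `c n = 1/(2ⁿ·(n+1)!)`. -/
noncomputable def cseq (n : ℕ) : ℝ := 1 / (2 ^ n * (Nat.factorial (n + 1)))

/-- `Y = Σ_{n ≥ 3} n!·1_{[c_{n+1}, c_n)}`. -/
noncomputable def Yfun : ℝ → ℝ := fun t =>
  ∑' n : ℕ, (Set.Ico (cseq (n + 4)) (cseq (n + 3))).indicator
    (fun _ => ((n + 3).factorial : ℝ)) t

/-- `X = Y − E[Y]·1`. -/
noncomputable def Xfun : ℝ → ℝ := fun t => Yfun t - ∫ s, Yfun s ∂μ01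

instance : IsProbabilityMeasure μ01 := ⟨by simp [μ01]⟩

instance : NullSingletonClass μ01 := by unfold μ01; infer_instance

theorem exists_subset_μ01_real_eq {S : Set ℝ} (hS : NullMeasurableSet S μ01) {s : ℝ} (hs : 0 ≤ s)
    (hsS : s ≤ μ01.real S) : ∃ A ⊆ S, NullMeasurableSet A μ01 ∧ μ01.real A = s := by
  have : NullSingletonClass (μ01.restrict S) :=
    ⟨fun x => Measure.restrict_le_self.absolutelyContinuous (measure_singleton x)⟩
  set F : ℝ → ℝ := fun t => ∫ _ in (0 : ℝ)..t, (1 : ℝ) ∂(μ01.restrict S)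
  have hF : ∀ t, 0 ≤ t → F t = μ01.real (S ∩ Set.Ioc 0 t) := by
    intro t ht
    simp only [F]
    rw [intervalIntegral.integral_of_le ht, Measure.restrict_restrict measurableSet_Ioc]
    simp [Set.inter_comm]
  have hcont : Continuous F :=
    intervalIntegral.continuous_primitive (fun a b => intervalIntegrable_const) 0
  have hF1 : F 1 = μ01.real S := by
    rw [hF 1 zero_le_one]
    refine measureReal_congr ?_
    have h : ∀ᵐ x ∂μ01, x ∈ Set.Ioc (0 : ℝ) 1 := by
      rw [μ01, restrict_Ioc_eq_restrict_Icc.symm]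
      exact ae_restrict_mem measurableSet_Ioc
    filter_upwards [h] with x hx
    exact propext ⟨fun h => h.1, fun h => ⟨h, hx⟩⟩
  obtain ⟨t, ht, hts⟩ := intermediate_value_Icc zero_le_one hcont.continuousOn
    (show s ∈ Set.Icc (F 0) (F 1) from ⟨by simpa [F] using hs, hF1 ▸ hsS⟩)
  exact ⟨S ∩ Set.Ioc 0 t, Set.inter_subset_left, hS.inter measurableSet_Ioc.nullMeasurableSet,
    by rw [← hF t ht.1, hts]⟩

theorem mul_lintegral_le_Nnorm (f : ℝ → ℝ) {A : Set ℝ} (hA : NullMeasurableSet A μ01) {n : ℕ}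
    (hn : 1 ≤ n) (hAn : μ01.real A ≤ 1 / (2 ^ n * n.factorial)) :
    ((n : ℝ≥0∞) * 2 ^ n) * ∫⁻ t in A, ENNReal.ofReal |f t| ∂μ01 ≤ Nnorm f := by
  obtain ⟨A', hA'A, hA'm, hA'⟩ := hA.exists_measurable_subset_ae_eq
  have hIcc : (A' ∩ Set.Icc 0 1 : Set ℝ) =ᵐ[μ01] A := by
    have h : ∀ᵐ x ∂μ01, x ∈ Set.Icc (0 : ℝ) 1 := ae_restrict_mem measurableSet_Icc
    refine Filter.EventuallyEq.trans ?_ hA'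
    filter_upwards [h] with x hx
    exact propext ⟨fun h => h.1, fun h => ⟨h, hx⟩⟩
  have hle : μ01 A ≤ 1 / ((2 : ℝ≥0∞) ^ n * (n.factorial : ℝ≥0∞)) := by
    rw [← ENNReal.ofReal_toReal (measure_ne_top μ01 A)]
    refine (ENNReal.ofReal_le_ofReal hAn).trans_eq ?_
    rw [ENNReal.ofReal_div_of_pos (by positivity), ENNReal.ofReal_mul (by positivity),
      ENNReal.ofReal_pow (by positivity)]
    simp
  rw [← setLIntegral_congr hIcc]
  refine le_trans ?_ (le_iSup₂ (f := fun (n : ℕ) (_ : 1 ≤ n) => ((n : ℝ≥0∞) * 2 ^ n) *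
      ⨆ (A : Set ℝ) (_ : MeasurableSet A) (_ : A ⊆ Set.Icc (0 : ℝ) 1)
        (_ : μ01 A ≤ 1 / ((2 : ℝ≥0∞) ^ n * (Nat.factorial n : ℝ≥0∞))),
        ∫⁻ t in A, ENNReal.ofReal |f t| ∂μ01) n hn)
  gcongr
  refine le_trans ?_ (le_iSup₂ (A' ∩ Set.Icc 0 1 : Set ℝ) (hA'm.inter measurableSet_Icc))
  exact le_trans le_rfl (le_iSup₂ (f := fun _ _ =>
    ∫⁻ t in A' ∩ Set.Icc 0 1, ENNReal.ofReal |f t| ∂μ01)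
    Set.inter_subset_right ((measure_congr hIcc).trans_le hle))

theorem mul_setIntegral_le_toReal_Nnorm {f : ℝ → ℝ} (hf : Integrable f μ01) (hN : Nnorm f < ∞)
    {A : Set ℝ} (hA : NullMeasurableSet A μ01) {n : ℕ}
    (hn : 1 ≤ n) (hAn : μ01.real A ≤ 1 / (2 ^ n * n.factorial)) :
    ((n : ℝ) * 2 ^ n) * ∫ t in A, |f t| ∂μ01 ≤ (Nnorm f).toReal := by
  have h := ENNReal.toReal_mono hN.ne (mul_lintegral_le_Nnorm f hA hn hAn)
  rw [integral_eq_lintegral_of_nonneg_ae (Filter.Eventually.of_forall fun x => abs_nonneg _)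
    hf.abs.aestronglyMeasurable.restrict]
  simpa using h

/-- If the integral of `h` over small sets is controlled by `C < l * s`, then the superlevel set
of `h` at height `l` is small. -/
theorem μ01_real_superlevel_le {h : ℝ → ℝ} (hh : Integrable h μ01) {s C l : ℝ} (hs : 0 ≤ s)
    (hl : C < l * s)
    (hC : ∀ A, NullMeasurableSet A μ01 → μ01.real A ≤ s → ∫ t in A, h t ∂μ01 ≤ C) :
    μ01.real {t | l < h t} ≤ s := by
  by_contra! hlt
  obtain ⟨A, hAE, hAm, hAs⟩ := exists_subset_μ01_real_eq
    (nullMeasurableSet_lt aemeasurable_const hh.aemeasurable) hs hlt.le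
  have h1 := hC A hAm hAs.le
  have h2 : ∫ t in A, l ∂μ01 ≤ ∫ t in A, h t ∂μ01 :=
    setIntegral_mono_on_ae₀ (integrable_const _).integrableOn hh.integrableOn hAm
      (Filter.Eventually.of_forall fun x hx => (hAE hx).le)
  simp [hAs] at h2
  nlinarith

theorem sum_dyadic_lt_le {l x : ℝ} (hl : 0 ≤ l) (J : ℕ) :
    ∑ j ∈ Finset.range J, (if 2 ^ j * l < x then 2 ^ j * l else 0) ≤ if l < x then 2 * x else 0 := by
  split_ifs with hlx
  · induction J with
    | zero => simp; linarith
    | succ J ih =>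
      rw [Finset.sum_range_succ]
      split_ifs with h
      · have h1 : ∑ j ∈ Finset.range J, (if 2 ^ j * l < x then 2 ^ j * l else 0)
            ≤ ∑ j ∈ Finset.range J, 2 ^ j * l :=
          Finset.sum_le_sum fun j _ => by split_ifs; exacts [le_rfl, by positivity]
        rw [← Finset.sum_mul, geom_sum_eq (by norm_num)] at h1
        norm_num at h1
        linarith
      · simpa using ih
  · refine Finset.sum_nonpos fun j _ => ?_
    rw [if_neg]
    push Not at hlx ⊢
    exact hlx.trans (le_mul_of_one_le_left hl (one_le_pow₀ one_le_two))

theorem exists_dyadic_superlevel_le {h : ℝ → ℝ} (hh : Integrable h μ01) {l C : ℝ} (hl : 0 ≤ l)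
    (hC : ∫ t in {t | l < h t}, h t ∂μ01 ≤ C) {J : ℕ} (hJ : 0 < J) :
    ∃ j < J, 2 ^ j * l * μ01.real {t | 2 ^ j * l < h t} ≤ 2 * C / J := by
  have hm : ∀ r : ℝ, NullMeasurableSet {t | r < h t} μ01 := fun r =>
    nullMeasurableSet_lt aemeasurable_const hh.aemeasurable
  have key : ∑ j ∈ Finset.range J, 2 ^ j * l * μ01.real {t | 2 ^ j * l < h t} ≤
      ∑ j ∈ Finset.range J, 2 * C / J := by
    have e1 : ∀ j : ℕ, 2 ^ j * l * μ01.real {t | 2 ^ j * l < h t} =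
        ∫ t, {t | 2 ^ j * l < h t}.indicator (fun _ => 2 ^ j * l) t ∂μ01 := fun j => by
      rw [integral_indicator₀ (hm _)]
      simp [mul_comm]
    rw [Finset.sum_congr rfl fun j _ => e1 j, ← integral_finsetSum]
    · calc _ ≤ ∫ t, {t | l < h t}.indicator (fun t => 2 * h t) t ∂μ01 := by
            refine integral_mono (integrable_finsetSum _ fun j _ =>
              (integrable_const _).indicator₀ (hm _)) ((hh.const_mul 2).indicator₀ (hm _)) ?_
            intro t
            simpa [Set.indicator_apply] using sum_dyadic_lt_le (x := h t) hl J
        _ = 2 * ∫ t in {t | l < h t}, h t ∂μ01 := by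
            rw [integral_indicator₀ (hm _), integral_const_mul]
        _ ≤ 2 * C := by linarith
        _ = _ := by
            have : (J : ℝ) ≠ 0 := by positivity
            simp; field_simp
    · exact fun j _ => (integrable_const _).indicator₀ (hm _)
  obtain ⟨j, hj, h⟩ := Finset.exists_le_of_sum_le (by simpa using hJ.ne') key
  exact ⟨j, Finset.mem_range.1 hj, h⟩

theorem abs_setIntegral_sub_le {U V : ℝ → ℝ} (hU : Integrable U μ01) (hV : Integrable V μ01)
    (hUV : IdentDistrib U V μ01 μ01) {B : Set ℝ} (hB : NullMeasurableSet B μ01) {l : ℝ}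
    (hl : 0 ≤ l) (hBU : {t | l < |U t|} ⊆ B) (hBV : {t | l < |V t|} ⊆ B) :
    ∫ t in B, (U t - V t) ∂μ01 ≤ 2 * l * μ01.real B := by
  have split : ∀ W : ℝ → ℝ, Integrable W μ01 → {t | l < |W t|} ⊆ B →
      |∫ t in B, W t ∂μ01 - ∫ t, {x : ℝ | l < |x|}.indicator id (W t) ∂μ01|
        ≤ l * μ01.real B := by
    intro W hW hBW
    have hm : NullMeasurableSet {t | l < |W t|} μ01 :=
      nullMeasurableSet_lt aemeasurable_const hW.abs.aemeasurable
    have e : ∫ t, {x : ℝ | l < |x|}.indicator id (W t) ∂μ01 =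
        ∫ t in {t | l < |W t|}, W t ∂μ01 := by
      rw [← integral_indicator₀ hm]
      rfl
    have e2 : ∫ t in B, W t ∂μ01 =
        ∫ t in {t | l < |W t|}, W t ∂μ01 + ∫ t in B \ {t | l < |W t|}, W t ∂μ01 := by
      rw [← setIntegral_union₀ (Disjoint.aedisjoint Set.disjoint_sdiff_right) (hB.diff hm)
        hW.integrableOn hW.integrableOn, Set.union_sdiff_cancel hBW]
    rw [e, e2, add_sub_cancel_left]
    refine (norm_setIntegral_le_of_norm_le_const (f := W) (C := l) (measure_lt_top _ _)
      fun x hx => not_lt.1 hx.2).trans ?_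
    exact mul_le_mul_of_nonneg_left (measureReal_mono Set.sdiff_subset) hl
  have hi : ∫ t, {x : ℝ | l < |x|}.indicator id (U t) ∂μ01 =
      ∫ t, {x : ℝ | l < |x|}.indicator id (V t) ∂μ01 :=
    (hUV.comp (measurable_id.indicator
      (measurableSet_lt measurable_const measurable_norm))).integral_eq
  rw [integral_sub hU.integrableOn hV.integrableOn]
  have h1 := abs_le.1 (split U hU hBU)
  have h2 := abs_le.1 (split V hV hBV)
  linarith [h1.2, h2.1]

theorem cseq_antitone : Antitone cseq := by
  refine antitone_nat_of_succ_le fun n => ?_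
  unfold cseq
  gcongr
  · norm_num
  · omega
  · omega

theorem cseq_pos (n : ℕ) : 0 < cseq n := by unfold cseq; positivity

theorem Yfun_nonneg (t : ℝ) : 0 ≤ Yfun t :=
  tsum_nonneg fun _ => Set.indicator_nonneg (fun _ _ => by positivity) _

theorem Yfun_eq {n : ℕ} (hn : 3 ≤ n) {t : ℝ} (ht : t ∈ Set.Ico (cseq (n + 1)) (cseq n)) :
    Yfun t = n.factorial := by
  obtain ⟨k, rfl⟩ := Nat.exists_eq_add_of_le' hn
  rw [Yfun, tsum_eq_single k]
  · simp only [Set.indicator_of_mem (show t ∈ Set.Ico (cseq (k + 4)) (cseq (k + 3)) from ht)]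
  · intro j hj
    refine Set.indicator_of_notMem (fun htj => ?_) _
    rcases lt_or_gt_of_ne hj with h | h
    · exact absurd (htj.1.trans_lt ht.2) (not_lt.2 (cseq_antitone (by omega)))
    · exact absurd (ht.1.trans_lt htj.2) (not_lt.2 (cseq_antitone (by omega)))

theorem indicator_sub_abs_le_Xfun {n : ℕ} (hn : 3 ≤ n) (t : ℝ) :
    (Set.Ico (cseq (n + 1)) (cseq n)).indicator (fun _ => (n.factorial : ℝ)) t
      - |∫ s, Yfun s ∂μ01| ≤ Xfun t := by
  unfold Xfun
  refine sub_le_sub ?_ (le_abs_self _)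
  by_cases ht : t ∈ Set.Ico (cseq (n + 1)) (cseq n)
  · rw [Set.indicator_of_mem ht, Yfun_eq hn ht]
  · rw [Set.indicator_of_notMem ht]
    exact Yfun_nonneg t

theorem cseq_eq (n : ℕ) : cseq n = 1 / (2 ^ n * n.factorial) / (n + 1) := by
  unfold cseq
  rw [Nat.factorial_succ]
  push_cast
  field_simp

theorem half_le_mul_cseq_sub {n : ℕ} (hn : 2 ≤ n) :
    1 / 2 ≤ (n : ℝ) * 2 ^ n * (n.factorial * (cseq n - cseq (n + 1))) := by
  have hn' : (2 : ℝ) ≤ n := by exact_mod_cast hn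
  have e : (n : ℝ) * 2 ^ n * (n.factorial * (cseq n - cseq (n + 1))) =
      n * (2 * n + 3) / (2 * (n + 1) * (n + 2)) := by
    unfold cseq
    rw [Nat.factorial_succ (n + 1), Nat.factorial_succ n]
    push_cast
    field_simp
    ring
  rw [e, div_le_div_iff₀ (by positivity) (by positivity)]
  nlinarith

theorem μ01_real_Ico_cseq (n : ℕ) : μ01.real (Set.Ico 0 (cseq n)) = cseq n ∧
    μ01.real (Set.Ico (cseq (n + 1)) (cseq n)) = cseq n - cseq (n + 1) := by
  have h1 : cseq n ≤ 1 := by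
    refine (cseq_antitone (Nat.zero_le n)).trans ?_
    norm_num [cseq]
  have h : ∀ a, 0 ≤ a → a ≤ cseq n → μ01.real (Set.Ico a (cseq n)) = cseq n - a := by
    intro a ha han
    rw [μ01, measureReal_restrict_apply measurableSet_Ico, Set.inter_eq_left.2,
      Real.volume_real_Ico_of_le han]
    exact fun x hx => ⟨ha.trans hx.1, hx.2.le.trans h1⟩
  exact ⟨by simpa using h 0 le_rfl (cseq_pos n).le,
    h _ (cseq_pos _).le (cseq_antitone n.le_succ)⟩

theorem ofReal_setIntegral_le_lintegral_abs {g f : ℝ → ℝ} {B : Set ℝ}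
    (hg : Integrable g μ01) (hgf : ∀ t, g t ≤ |f t|) :
    ENNReal.ofReal (∫ t in B, g t ∂μ01) ≤ ∫⁻ t in B, ENNReal.ofReal |f t| ∂μ01 := by
  calc ENNReal.ofReal (∫ t in B, g t ∂μ01)
      ≤ ENNReal.ofReal (∫ t in B, max (g t) 0 ∂μ01) :=
        ENNReal.ofReal_le_ofReal (setIntegral_mono hg.integrableOn hg.pos_part.integrableOn
          fun t => le_max_left _ _)
    _ = ∫⁻ t in B, ENNReal.ofReal (max (g t) 0) ∂μ01 :=
        ofReal_integral_eq_lintegral_ofReal hg.pos_part.integrableOn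
          (Filter.Eventually.of_forall fun t => le_max_right _ _)
    _ ≤ _ := lintegral_mono fun t =>
        ENNReal.ofReal_le_ofReal (max_le (hgf t) (abs_nonneg _))

/-- Integrals over a union of two small sets are controlled by twice the norm. -/
theorem mul_setIntegral_union_le {g f : ℝ → ℝ} (hg : Integrable g μ01) (hgf : ∀ t, g t ≤ |f t|)
    {C : ℝ} (hC : 0 ≤ C) (hf : Nnorm f ≤ ENNReal.ofReal C) {D E : Set ℝ}
    (hD : NullMeasurableSet D μ01) (hE : NullMeasurableSet E μ01) {n : ℕ} (hn : 1 ≤ n)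
    (hDn : μ01.real D ≤ 1 / (2 ^ n * n.factorial)) (hEn : μ01.real E ≤ 1 / (2 ^ n * n.factorial)) :
    (n : ℝ) * 2 ^ n * ∫ t in D ∪ E, g t ∂μ01 ≤ 2 * C := by
  rw [← ENNReal.ofReal_le_ofReal_iff (by positivity), ENNReal.ofReal_mul (by positivity)]
  have e : ENNReal.ofReal ((n : ℝ) * 2 ^ n) = (n : ℝ≥0∞) * 2 ^ n := by
    rw [ENNReal.ofReal_mul (by positivity), ENNReal.ofReal_pow (by positivity)]
    simp
  rw [e]
  calc _ ≤ (n : ℝ≥0∞) * 2 ^ n * (∫⁻ t in D ∪ E, ENNReal.ofReal |f t| ∂μ01) := by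
        gcongr
        exact ofReal_setIntegral_le_lintegral_abs hg hgf
    _ ≤ (n : ℝ≥0∞) * 2 ^ n * (∫⁻ t in D, ENNReal.ofReal |f t| ∂μ01
          + ∫⁻ t in E, ENNReal.ofReal |f t| ∂μ01) := by
        gcongr
        exact lintegral_union_le _ _ _
    _ ≤ ENNReal.ofReal C + ENNReal.ofReal C := by
        rw [mul_add]
        exact add_le_add ((mul_lintegral_le_Nnorm f hD hn hDn).trans hf)
          ((mul_lintegral_le_Nnorm f hE hn hEn).trans hf)
    _ = ENNReal.ofReal (2 * C) := by rw [← ENNReal.ofReal_add hC hC, two_mul]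

/-- The counterexample: `X = Y - E[Y]·1` has mean zero but stays at `N`-distance at least
`1/8` from the span of differences of identically distributed functions of finite norm. -/
theorem Xfun_not_in_closure_span
    (m : ℕ) (U V : Fin m → ℝ → ℝ)
    (hU : ∀ i, Integrable (U i) μ01) (hV : ∀ i, Integrable (V i) μ01)
    (hNU : ∀ i, Nnorm (U i) < ∞) (hNV : ∀ i, Nnorm (V i) < ∞)
    (hUV : ∀ i, IdentDistrib (U i) (V i) μ01 μ01) :
    (1 / 8 : ℝ≥0∞) ≤ Nnorm (fun t => Xfun t - ∑ i, (U i t - V i t)) := by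
  by_contra! hlt
  set e : ℝ := |∫ s, Yfun s ∂μ01| with he
  have he0 : 0 ≤ e := abs_nonneg _
  set K : ℝ := ∑ i, ((Nnorm (U i)).toReal + (Nnorm (V i)).toReal) with hKdef
  have hK : 0 ≤ K := Finset.sum_nonneg fun i _ => by positivity
  set h : ℝ → ℝ := fun t => ∑ i, (|U i t| + |V i t|) with hhdef
  have hUh : ∀ i t, |U i t| ≤ h t := fun i t =>
    (le_add_of_nonneg_right (abs_nonneg _)).trans
      (Finset.single_le_sum (f := fun i => |U i t| + |V i t|) (fun _ _ => by positivity)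
        (Finset.mem_univ i))
  have hVh : ∀ i t, |V i t| ≤ h t := fun i t =>
    (le_add_of_nonneg_left (abs_nonneg _)).trans
      (Finset.single_le_sum (f := fun i => |U i t| + |V i t|) (fun _ _ => by positivity)
        (Finset.mem_univ i))
  have habs : ∀ i, Integrable (fun t => |U i t| + |V i t|) μ01 := fun i =>
    (hU i).abs.add (hV i).abs
  have hh : Integrable h μ01 := integrable_finsetSum _ fun i _ => habs i
  have hdiff : ∀ i, Integrable (fun t => U i t - V i t) μ01 := fun i => (hU i).sub (hV i)
  obtain ⟨J, hJ⟩ := exists_nat_ge (20 * (2 * m + 1) * K + 1 : ℝ)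
  have hJ1 : (0 : ℝ) < J := lt_of_lt_of_le (by positivity) hJ
  set L : ℝ := K + e + 1 with hL
  obtain ⟨n₀, hn₀⟩ := exists_nat_ge (10 * (2 * m + 1) * (2 ^ J * L) : ℝ)
  obtain ⟨n, hn3, hnn⟩ : ∃ n : ℕ, 3 ≤ n ∧ n₀ ≤ n := ⟨n₀ + 3, by omega, by omega⟩
  have hn : (10 * (2 * m + 1) * (2 ^ J * L) : ℝ) ≤ n := hn₀.trans (by exact_mod_cast hnn)
  have hnpos : (0 : ℝ) < n := by positivity
  set N : ℝ := n * 2 ^ n with hN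
  have hNpos : 0 < N := by positivity
  set s : ℝ := 1 / (2 ^ n * n.factorial) with hs
  have hspos : 0 < s := by positivity
  set l : ℝ := L * (n - 1).factorial with hldef
  have hfac : (n.factorial : ℝ) = n * (n - 1).factorial := by
    exact_mod_cast (Nat.mul_factorial_pred (by omega : n ≠ 0)).symm
  have hls : l * s = L / N := by
    rw [hldef, hs, hN, hfac]
    field_simp
  have hLpos : 0 < L := by positivity
  have hel : e ≤ l := by
    have h1 : (1 : ℝ) ≤ (n - 1).factorial := by exact_mod_cast Nat.factorial_pos _
    exact (show e ≤ L by linarith).trans (le_mul_of_one_le_right hLpos.le h1)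
  have hl0 : 0 ≤ l := he0.trans hel
  have hC : ∀ A, NullMeasurableSet A μ01 → μ01.real A ≤ s → ∫ t in A, h t ∂μ01 ≤ K / N := by
    intro A hA hAs
    rw [le_div_iff₀' hNpos, hhdef, integral_finsetSum _
      fun i _ => (habs i).integrableOn, Finset.mul_sum]
    refine Finset.sum_le_sum fun i _ => ?_
    rw [integral_add (hU i).abs.integrableOn (hV i).abs.integrableOn, mul_add]
    exact add_le_add (mul_setIntegral_le_toReal_Nnorm (hU i) (hNU i) hA (by omega) hAs)
      (mul_setIntegral_le_toReal_Nnorm (hV i) (hNV i) hA (by omega) hAs)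
  have hm : ∀ r : ℝ, NullMeasurableSet {t | r < h t} μ01 := fun r =>
    nullMeasurableSet_lt aemeasurable_const hh.aemeasurable
  have hsl : μ01.real {t | l < h t} ≤ s :=
    μ01_real_superlevel_le hh hspos.le (by rw [hls]; gcongr; linarith) hC
  obtain ⟨j, hjJ, hj⟩ := exists_dyadic_superlevel_le hh hl0 (hC _ (hm l) hsl)
    (by exact_mod_cast hJ1 : 0 < J)
  set r : ℝ := 2 ^ j * l with hr
  have hlr : l ≤ r := le_mul_of_one_le_left hl0 (one_le_pow₀ one_le_two)
  have hrs : μ01.real {t | r < h t} ≤ s :=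
    (measureReal_mono fun t ht => lt_of_le_of_lt hlr ht).trans hsl
  have hDs : μ01.real (Set.Ico 0 (cseq n)) ≤ s := by
    rw [(μ01_real_Ico_cseq n).1, cseq_eq]
    exact div_le_self hspos.le (by linarith)
  set B : Set ℝ := {t | r < h t} ∪ Set.Ico 0 (cseq n) with hB
  have hBm : NullMeasurableSet B μ01 := (hm r).union measurableSet_Ico.nullMeasurableSet
  have hBle : μ01.real B ≤ μ01.real {t | r < h t} + cseq n :=
    (measureReal_union_le _ _).trans_eq (by rw [(μ01_real_Ico_cseq n).1])
  set D : Set ℝ := Set.Ico (cseq (n + 1)) (cseq n) with hD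
  have hDr : μ01.real D = cseq n - cseq (n + 1) := (μ01_real_Ico_cseq n).2
  have hDB : D ⊆ B := fun t ht => Or.inr ⟨(cseq_pos _).le.trans ht.1, ht.2⟩
  have hint1 : Integrable (D.indicator fun _ => (n.factorial : ℝ)) μ01 :=
    (integrable_const _).indicator measurableSet_Ico
  have hint1e : Integrable (fun t => D.indicator (fun _ => (n.factorial : ℝ)) t - e) μ01 :=
    hint1.sub (integrable_const e)
  have hint2 : Integrable (fun t => ∑ i, (U i t - V i t)) μ01 :=
    integrable_finsetSum _ fun i _ => hdiff i
  have hg : Integrable (fun t => D.indicator (fun _ => (n.factorial : ℝ)) t - e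
      - ∑ i, (U i t - V i t)) μ01 := hint1e.sub hint2
  have hupper := mul_setIntegral_union_le hg
    (f := fun t => Xfun t - ∑ i, (U i t - V i t))
    (fun t => (sub_le_sub_right (indicator_sub_abs_le_Xfun hn3 t) _).trans (le_abs_self _))
    (C := 1 / 8) (by norm_num) (hlt.le.trans_eq (by
      rw [ENNReal.ofReal_div_of_pos (by norm_num)]; simp)) (hm r)
    measurableSet_Ico.nullMeasurableSet (by omega) hrs hDs
  have hsum : ∫ t in B, ∑ i, (U i t - V i t) ∂μ01 ≤ 2 * m * r * μ01.real B := by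
    rw [integral_finsetSum _ fun i _ => (hdiff i).integrableOn]
    refine (Finset.sum_le_sum fun i _ => abs_setIntegral_sub_le (hU i) (hV i) (hUV i) hBm
      (hl0.trans hlr) (fun t ht => Or.inl (lt_of_lt_of_le ht (hUh i t)))
      (fun t ht => Or.inl (lt_of_lt_of_le ht (hVh i t)))).trans_eq ?_
    simp
    ring
  have hlower : n.factorial * (cseq n - cseq (n + 1)) - (2 * m + 1) * (r * μ01.real B) ≤
      ∫ t in B, (D.indicator (fun _ => (n.factorial : ℝ)) t - e - ∑ i, (U i t - V i t)) ∂μ01 := by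
    rw [integral_sub hint1e.integrableOn hint2.integrableOn,
      integral_sub hint1.integrableOn (integrable_const e).integrableOn,
      setIntegral_indicator measurableSet_Ico, Set.inter_eq_right.2 hDB]
    simp only [setIntegral_const, smul_eq_mul, hDr]
    have := mul_le_mul_of_nonneg_right (hel.trans hlr) (measureReal_nonneg (μ := μ01) (s := B))
    linarith
  have hrB : N * (r * μ01.real B) ≤ 2 * K / J + 2 ^ J * L / n := by
    have h1 : N * (r * μ01.real {t | r < h t}) ≤ 2 * K / J := by
      refine (mul_le_mul_of_nonneg_left hj hNpos.le).trans_eq ?_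
      field_simp
    have h2 : N * (r * cseq n) ≤ 2 ^ J * L / n := by
      rw [cseq_eq, hr, show N * (2 ^ j * l * (1 / (2 ^ n * n.factorial) / (n + 1)))
        = 2 ^ j * (N * (l * s)) / (n + 1) by rw [hs]; ring, hls, mul_div_cancel₀ _ hNpos.ne']
      gcongr
      · norm_num
      · linarith
    calc N * (r * μ01.real B) ≤ N * (r * (μ01.real {t | r < h t} + cseq n)) := by
          have := hl0.trans hlr
          gcongr
      _ ≤ _ := by linarith
  have hb1 : (2 * m + 1) * (2 * K / J) ≤ 1 / 10 := by
    rw [mul_div_assoc', div_le_iff₀ hJ1]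
    linarith
  have hb2 : (2 * m + 1) * (2 ^ J * L / n) ≤ 1 / 10 := by
    rw [mul_div_assoc', div_le_iff₀ hnpos]
    linarith
  have hhalf := half_le_mul_cseq_sub (n := n) (by omega)
  have hfin := (mul_le_mul_of_nonneg_left hlower hNpos.le).trans hupper
  have hmul := mul_le_mul_of_nonneg_left hrB (by positivity : (0 : ℝ) ≤ 2 * m + 1)
  linarith
end
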